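/- arXiv:2411.08303 — 3 statements merged into one kernel-verified Lean document; each statement's English description precedes it below -/
import Mathlib

section
/- Let X and X' be n×m centered Gaussian random matrices (n, m ≥ 1), i.e. each of (X_{i,j}) and (X'_{i,j}), viewed as an ℝ^{nm}-valued random vector, is jointly Gaussian with mean zero (entries within each matrix need not be independent). Then for every β > 0, δ > 0 and τ > 1/(β(1+δ)), there exist random variables V and W on some probability space such that V has the same distribution as min_{1≤i≤n} max_{1≤j≤m} X_{i,j}, W has the same distribution as min_{1≤i≤n} max_{1≤j≤m} X'_{i,j}, and P(|V − W| > 2((log n)/(βδ) ∨ (log m)/β) + 3τ) ≤ (ε + C β(1+δ) τ⁻¹ B₃)/(1 − ε), where C > 0 is a universal constant. -/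
open MeasureTheory ProbabilityTheory Real

/-- `X` is a centered (jointly) Gaussian random matrix under `P`: every linear combination
of its entries has a centered real Gaussian distribution. -/
def IsCenteredGaussianMatrix {Ω : Type*} [MeasurableSpace Ω] (P : Measure Ω)
    {n m : ℕ} (X : Ω → Fin n → Fin m → ℝ) : Prop :=
  ∀ c : Fin n → Fin m → ℝ, ∃ v : NNReal,
    Measure.map (fun ω => ∑ i, ∑ j, c i j * X ω i j) P = gaussianReal 0 v

section Bump

/-- A smooth bump supported in `[0, 2]` whose integer translates sum to one. -/
noncomputable def stepBump (t : ℝ) : ℝ := smoothTransition t - smoothTransition (t - 1)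

lemma stepBump_nonneg (t : ℝ) : 0 ≤ stepBump t :=
  sub_nonneg.2 (smoothTransition.monotone (by linarith))

lemma stepBump_of_nonpos {t : ℝ} (h : t ≤ 0) : stepBump t = 0 := by
  rw [stepBump, smoothTransition.zero_of_nonpos h, smoothTransition.zero_of_nonpos (by linarith),
    sub_self]

lemma stepBump_of_two_le {t : ℝ} (h : 2 ≤ t) : stepBump t = 0 := by
  rw [stepBump, smoothTransition.one_of_one_le (by linarith),
    smoothTransition.one_of_one_le (by linarith), sub_self]

lemma stepBump_le_one (t : ℝ) : stepBump t ≤ 1 := by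
  have h1 := smoothTransition.le_one t
  have h2 := smoothTransition.nonneg (t - 1)
  rw [stepBump]; linarith

lemma contDiff_stepBump {n : ℕ∞} : ContDiff ℝ n stepBump :=
  smoothTransition.contDiff.sub (smoothTransition.contDiff.comp (contDiff_id.sub contDiff_const))

lemma continuous_stepBump : Continuous stepBump := (contDiff_stepBump (n := 0)).continuous

lemma tsupport_stepBump_subset : tsupport stepBump ⊆ Set.Icc 0 2 := by
  refine closure_minimal (fun t ht => ?_) isClosed_Icc
  by_contra h
  rw [Set.mem_Icc, not_and_or, not_le, not_le] at h
  rcases h with h | h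
  · exact ht (stepBump_of_nonpos h.le)
  · exact ht (stepBump_of_two_le h.le)

lemma hasCompactSupport_stepBump : HasCompactSupport stepBump :=
  isCompact_Icc.of_isClosed_subset (isClosed_tsupport _) tsupport_stepBump_subset

lemma tsum_ofReal_stepBump (t : ℝ) : ∑' k : ℤ, ENNReal.ofReal (stepBump (t - k)) = 1 := by
  have h0 := Int.floor_le t
  have h1 := Int.lt_floor_add_one t
  rw [tsum_eq_sum (s := {⌊t⌋ - 1, ⌊t⌋})]
  · rw [Finset.sum_insert (by simp), Finset.sum_singleton,
      ← ENNReal.ofReal_add (stepBump_nonneg _) (stepBump_nonneg _)]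
    simp only [stepBump]
    push_cast
    rw [smoothTransition.one_of_one_le (show 1 ≤ t - (⌊t⌋ - 1) by linarith),
      smoothTransition.zero_of_nonpos (show t - ⌊t⌋ - 1 ≤ 0 by linarith),
      show t - (⌊t⌋ - 1) - 1 = t - ⌊t⌋ by ring]
    simp
  · intro k hk
    simp only [Finset.mem_insert, Finset.mem_singleton, not_or] at hk
    rw [ENNReal.ofReal_eq_zero]
    rcases lt_or_ge ⌊t⌋ k with h | h
    · have : (⌊t⌋ : ℝ) + 1 ≤ k := by exact_mod_cast h
      exact (stepBump_of_nonpos (by linarith)).le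
    · have : k ≤ ⌊t⌋ - 2 := by omega
      have : (k : ℝ) ≤ ⌊t⌋ - 2 := by exact_mod_cast this
      exact (stepBump_of_two_le (by linarith)).le

lemma exists_deriv_stepBump : ∃ (ψ₁ ψ₂ : ℝ → ℝ) (c : ℝ), 0 < c ∧
    (∀ t, HasDerivAt stepBump (ψ₁ t) t) ∧ (∀ t, HasDerivAt ψ₁ (ψ₂ t) t) ∧
    (∀ t, |ψ₁ t| ≤ c) ∧ (∀ t, |ψ₂ t| ≤ c) ∧ (∀ s t, |ψ₂ s - ψ₂ t| ≤ c * |s - t|) ∧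
    (∀ t, t ∉ Set.Icc (0 : ℝ) 2 → ψ₁ t = 0) ∧ (∀ t, t ∉ Set.Icc (0 : ℝ) 2 → ψ₂ t = 0) := by
  have h3 : ContDiff ℝ 3 stepBump := contDiff_stepBump (n := 3)
  have h2 : ContDiff ℝ 2 (deriv stepBump) := by
    have : ContDiff ℝ (2 + 1) stepBump := by norm_num; exact h3
    exact (contDiff_succ_iff_deriv.1 this).2.2
  have h1 : ContDiff ℝ 1 (deriv (deriv stepBump)) := by
    have : ContDiff ℝ (1 + 1) (deriv stepBump) := by norm_num; exact h2
    exact (contDiff_succ_iff_deriv.1 this).2.2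
  have c1 := hasCompactSupport_stepBump.deriv
  have c2 := c1.deriv
  obtain ⟨a1, ha1⟩ := c1.exists_bound_of_continuous h2.continuous
  obtain ⟨a2, ha2⟩ := c2.exists_bound_of_continuous h1.continuous
  obtain ⟨a3, ha3⟩ := h1.lipschitzWith_of_hasCompactSupport c2 (by norm_num)
  have s1 : tsupport (deriv stepBump) ⊆ Set.Icc 0 2 :=
    (tsupport_deriv_subset).trans tsupport_stepBump_subset
  have s2 : tsupport (deriv (deriv stepBump)) ⊆ Set.Icc 0 2 := (tsupport_deriv_subset).trans s1
  have hc : 0 < max (max a1 a2) (max a3 1) := by positivity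
  refine ⟨_, _, max (max a1 a2) (max a3 1), hc,
    fun t => (h3.differentiable (by norm_num) t).hasDerivAt,
    fun t => (h2.differentiable (by norm_num) t).hasDerivAt, fun t => (ha1 t).trans (by simp),
    fun t => (ha2 t).trans (by simp), fun s t => ?_,
    fun t ht => image_eq_zero_of_notMem_tsupport fun h => ht (s1 h),
    fun t ht => image_eq_zero_of_notMem_tsupport fun h => ht (s2 h)⟩
  have := ha3.dist_le_mul s t
  rw [Real.dist_eq, Real.dist_eq] at this
  refine this.trans (mul_le_mul_of_nonneg_right ?_ (abs_nonneg _))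
  simp

lemma abs_sum_translates_le {φ : ℝ → ℝ} {c : ℝ} (hc : ∀ t, |φ t| ≤ c)
    (h0 : ∀ t, t ∉ Set.Icc (0 : ℝ) 2 → φ t = 0) (S : Finset ℤ) (t : ℝ) :
    |∑ k ∈ S, φ (t - k)| ≤ 3 * c := by
  classical
  have hc0 : 0 ≤ c := (abs_nonneg _).trans (hc 0)
  calc |∑ k ∈ S, φ (t - k)| ≤ ∑ k ∈ S, |φ (t - k)| := Finset.abs_sum_le_sum_abs _ _
    _ ≤ ∑ k ∈ S, if k ∈ Finset.Icc (⌊t⌋ - 2) ⌊t⌋ then c else 0 := by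
      refine Finset.sum_le_sum fun k _ => ?_
      split_ifs with hk
      · exact hc _
      · rw [h0, abs_zero]
        intro h
        apply hk
        rw [Finset.mem_Icc]
        have h1 : k ≤ ⌊t⌋ := Int.le_floor.2 (by linarith [h.1])
        have h2 : ⌊t⌋ ≤ k + 2 := by
          have : ⌊t⌋ < k + 2 + 1 := Int.floor_lt.2 (by push_cast; linarith [h.2])
          omega
        omega
    _ = ∑ k ∈ S.filter (· ∈ Finset.Icc (⌊t⌋ - 2) ⌊t⌋), c := by rw [Finset.sum_filter]
    _ ≤ ∑ k ∈ Finset.Icc (⌊t⌋ - 2) ⌊t⌋, c :=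
      Finset.sum_le_sum_of_subset_of_nonneg (fun k hk => (Finset.mem_filter.1 hk).2)
        fun _ _ _ => hc0
    _ = 3 * c := by simp

lemma exists_smooth_window_sum : ∃ c : ℝ, 0 < c ∧ ∀ (τ : ℝ), 0 < τ → ∀ S : Finset ℤ,
    ∃ (G₁ G₂ : ℝ → ℝ) (K : ℝ),
      (∀ t, HasDerivAt (fun t => ∑ k ∈ S, stepBump (t / τ - k)) (G₁ t) t) ∧
      (∀ t, HasDerivAt G₁ (G₂ t) t) ∧
      (∀ t, |G₁ t| ≤ c / τ) ∧ (∀ t, |G₂ t| ≤ c / τ ^ 2) ∧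
      (∀ s t, |G₂ s - G₂ t| ≤ K * |s - t|) := by
  obtain ⟨ψ₁, ψ₂, c, hc, hd1, hd2, hb1, hb2, hl, hz1, hz2⟩ := exists_deriv_stepBump
  refine ⟨3 * c, by positivity, fun τ hτ S => ⟨fun t => (∑ k ∈ S, ψ₁ (t / τ - k)) / τ,
    fun t => (∑ k ∈ S, ψ₂ (t / τ - k)) / τ ^ 2, S.card * c / τ ^ 3, ?_, ?_, ?_, ?_, ?_⟩⟩
  · intro t
    simp only [Finset.sum_div]
    refine HasDerivAt.fun_sum fun k _ => ?_
    have h : HasDerivAt (fun t : ℝ => t / τ - k) (1 / τ) t :=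
      ((hasDerivAt_id t).div_const τ).sub_const _
    exact ((hd1 (t / τ - k)).comp t h).congr_deriv (mul_one_div _ _)
  · intro t
    have : HasDerivAt (fun t => ∑ k ∈ S, ψ₁ (t / τ - k)) (∑ k ∈ S, ψ₂ (t / τ - k) * (1 / τ)) t := by
      refine HasDerivAt.fun_sum fun k _ => ?_
      have h : HasDerivAt (fun t : ℝ => t / τ - k) (1 / τ) t :=
        ((hasDerivAt_id t).div_const τ).sub_const _
      exact (hd2 (t / τ - k)).comp t h
    refine (this.div_const τ).congr_deriv ?_
    rw [← Finset.sum_mul]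
    field_simp
  · intro t
    rw [abs_div, abs_of_pos hτ]
    gcongr
    exact abs_sum_translates_le hb1 hz1 S _
  · intro t
    rw [abs_div, abs_of_pos (by positivity : 0 < τ ^ 2)]
    gcongr
    exact abs_sum_translates_le hb2 hz2 S _
  · intro s t
    rw [← sub_div, abs_div, abs_of_pos (by positivity : 0 < τ ^ 2), ← Finset.sum_sub_distrib]
    calc |∑ k ∈ S, (ψ₂ (s / τ - k) - ψ₂ (t / τ - k))| / τ ^ 2
        ≤ (∑ k ∈ S, c * (|s - t| / τ)) / τ ^ 2 := by
          gcongr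
          refine (Finset.abs_sum_le_sum_abs _ _).trans (Finset.sum_le_sum fun k _ => ?_)
          refine (hl _ _).trans (le_of_eq ?_)
          rw [show s / τ - k - (t / τ - k) = (s - t) / τ by ring, abs_div, abs_of_pos hτ]
      _ = _ := by
        rw [Finset.sum_const, nsmul_eq_mul]
        field_simp

end Bump

section SoftMax

variable {ι : Type*} [Fintype ι]

/-- The log-sum-exp function. -/
noncomputable def logSumExp (y : ι → ℝ) : ℝ := log (∑ k, exp (y k))

/-- The softmax weights, i.e. the gradient of `logSumExp`. -/
noncomputable def softmax (y : ι → ℝ) (k : ι) : ℝ := exp (y k) / ∑ l, exp (y l)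

lemma sum_exp_pos [Nonempty ι] (y : ι → ℝ) : 0 < ∑ l, exp (y l) :=
  Finset.sum_pos (fun _ _ => exp_pos _) Finset.univ_nonempty

lemma softmax_nonneg (y : ι → ℝ) (k : ι) : 0 ≤ softmax y k :=
  div_nonneg (exp_pos _).le (Finset.sum_nonneg fun _ _ => (exp_pos _).le)

lemma sum_softmax [Nonempty ι] (y : ι → ℝ) : ∑ k, softmax y k = 1 := by
  simp only [softmax]
  rw [← Finset.sum_div, div_self (sum_exp_pos y).ne']

lemma hasDerivAt_sum_exp {y : ℝ → ι → ℝ} {y' : ι → ℝ} {s : ℝ}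
    (h : ∀ k, HasDerivAt (fun t => y t k) (y' k) s) :
    HasDerivAt (fun t => ∑ k, exp (y t k)) (∑ k, exp (y s k) * y' k) s :=
  HasDerivAt.fun_sum fun k _ => (h k).exp

lemma hasDerivAt_logSumExp [Nonempty ι] {y : ℝ → ι → ℝ} {y' : ι → ℝ} {s : ℝ}
    (h : ∀ k, HasDerivAt (fun t => y t k) (y' k) s) :
    HasDerivAt (fun t => logSumExp (y t)) (∑ k, softmax (y s) k * y' k) s := by
  refine ((hasDerivAt_sum_exp h).log (sum_exp_pos (y s)).ne').congr_deriv ?_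
  rw [Finset.sum_div]
  exact Finset.sum_congr rfl fun k _ => by rw [softmax]; ring

lemma hasDerivAt_softmax [Nonempty ι] {y : ℝ → ι → ℝ} {y' : ι → ℝ} {s : ℝ}
    (h : ∀ k, HasDerivAt (fun t => y t k) (y' k) s) (k : ι) :
    HasDerivAt (fun t => softmax (y t) k)
      (softmax (y s) k * (y' k - ∑ l, softmax (y s) l * y' l)) s := by
  have hp := (sum_exp_pos (y s)).ne'
  refine ((h k).exp.div (hasDerivAt_sum_exp h) hp).congr_deriv ?_
  have : ∑ l, softmax (y s) l * y' l = (∑ l, exp (y s l) * y' l) / ∑ l, exp (y s l) := by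
    rw [Finset.sum_div]
    exact Finset.sum_congr rfl fun k _ => by rw [softmax]; ring
  rw [this, softmax]
  field_simp

lemma iSup_le_logSumExp [Nonempty ι] (y : ι → ℝ) : ⨆ k, y k ≤ logSumExp y := by
  refine ciSup_le fun k => ?_
  rw [logSumExp, le_log_iff_exp_le (sum_exp_pos y)]
  exact Finset.single_le_sum (f := fun k => exp (y k)) (fun _ _ => (exp_pos _).le)
    (Finset.mem_univ k)

lemma logSumExp_le_iSup_add [Nonempty ι] (y : ι → ℝ) :
    logSumExp y ≤ (⨆ k, y k) + log (Fintype.card ι) := by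
  rw [logSumExp, log_le_iff_le_exp (sum_exp_pos y), exp_add,
    exp_log (by exact_mod_cast Fintype.card_pos)]
  calc ∑ k, exp (y k) ≤ ∑ _k : ι, exp (⨆ k, y k) :=
        Finset.sum_le_sum fun k _ => exp_le_exp.2 (le_ciSup (Finite.bddAbove_range y) k)
    _ = _ := by rw [Finset.sum_const, nsmul_eq_mul, mul_comm, Finset.card_univ]

end SoftMax

section SoftMinMax

variable {ι κ : Type*} [Fintype ι] [Fintype κ]

/-- A smooth approximation of `⨅ i, ⨆ j, x i j`. -/
noncomputable def softMinMax (β δ : ℝ) (x : ι → κ → ℝ) : ℝ :=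
  -(1 / (β * δ)) * logSumExp fun i => -δ * logSumExp fun j => β * x i j

/-- The inner softmax weights in the gradient of `softMinMax`. -/
noncomputable def innerWeight (β : ℝ) (x : ι → κ → ℝ) (i : ι) (j : κ) : ℝ :=
  softmax (fun j => β * x i j) j

/-- The outer softmax weights in the gradient of `softMinMax`. -/
noncomputable def outerWeight (β δ : ℝ) (x : ι → κ → ℝ) (i : ι) : ℝ :=
  softmax (fun i => -δ * logSumExp fun j => β * x i j) i

/-- The gradient of `softMinMax`. -/
noncomputable def minMaxWeight (β δ : ℝ) (x : ι → κ → ℝ) (i : ι) (j : κ) : ℝ :=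
  outerWeight β δ x i * innerWeight β x i j

/-- The Hessian of `softMinMax`. -/
noncomputable def minMaxHessian [DecidableEq ι] [DecidableEq κ] (β δ : ℝ) (x : ι → κ → ℝ) (i : ι)
    (j : κ) (k : ι) (l : κ) : ℝ :=
  β * minMaxWeight β δ x i j * ((if i = k then if j = l then 1 else 0 else 0)
    - (1 + δ) * (if i = k then innerWeight β x i l else 0) + δ * minMaxWeight β δ x k l)

omit [Fintype ι] in
lemma innerWeight_nonneg (β : ℝ) (x : ι → κ → ℝ) (i : ι) (j : κ) : 0 ≤ innerWeight β x i j :=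
  softmax_nonneg _ _

lemma minMaxWeight_nonneg (β δ : ℝ) (x : ι → κ → ℝ) (i : ι) (j : κ) :
    0 ≤ minMaxWeight β δ x i j := mul_nonneg (softmax_nonneg _ _) (softmax_nonneg _ _)

omit [Fintype ι] in
lemma sum_innerWeight [Nonempty κ] (β : ℝ) (x : ι → κ → ℝ) (i : ι) :
    ∑ j, innerWeight β x i j = 1 := sum_softmax _

lemma sum_minMaxWeight [Nonempty ι] [Nonempty κ] (β δ : ℝ) (x : ι → κ → ℝ) :
    ∑ i, ∑ j, minMaxWeight β δ x i j = 1 := by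
  simp only [minMaxWeight, ← Finset.mul_sum, sum_innerWeight, mul_one]
  exact sum_softmax _

lemma abs_softMinMax_sub_le [Nonempty ι] [Nonempty κ] {β δ : ℝ} (hβ : 0 < β) (hδ : 0 < δ)
    (x : ι → κ → ℝ) : |softMinMax β δ x - ⨅ i, ⨆ j, x i j| ≤
      max (log (Fintype.card ι) / (β * δ)) (log (Fintype.card κ) / β) := by
  have hi : ∀ i, β * (⨆ j, x i j) ≤ logSumExp (fun j => β * x i j) ∧
      logSumExp (fun j => β * x i j) ≤ β * (⨆ j, x i j) + log (Fintype.card κ) := fun i => by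
    rw [Real.mul_iSup_of_nonneg hβ.le]
    exact ⟨iSup_le_logSumExp _, logSumExp_le_iSup_add _⟩
  set m := ⨅ i, ⨆ j, x i j with hm
  have hmle : ∀ i, m ≤ ⨆ j, x i j := fun i =>
    ciInf_le (Finite.bddBelow_range fun i => ⨆ j, x i j) i
  obtain ⟨i₀, hi₀⟩ := exists_eq_ciInf_of_finite (f := fun i => ⨆ j, x i j)
  have h1 := logSumExp_le_iSup_add fun i => -δ * logSumExp fun j => β * x i j
  have h2 : ⨆ i, -δ * logSumExp (fun j => β * x i j) ≤ -(δ * (β * m)) := by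
    refine ciSup_le fun i => ?_
    have : δ * (β * m) ≤ δ * logSumExp (fun j => β * x i j) := by
      refine mul_le_mul_of_nonneg_left (le_trans ?_ (hi i).1) hδ.le
      exact mul_le_mul_of_nonneg_left (hmle i) hβ.le
    linarith
  have h3 := iSup_le_logSumExp fun i => -δ * logSumExp fun j => β * x i j
  have h4 : -(δ * (β * m + log (Fintype.card κ))) ≤ ⨆ i, -δ * logSumExp (fun j => β * x i j) := by
    refine le_trans ?_ (le_ciSup (Finite.bddAbove_range _) i₀)
    have := (hi i₀).2
    have h5 : (⨆ j, x i₀ j) = m := hi₀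
    rw [h5] at this
    have := mul_le_mul_of_nonneg_left this hδ.le
    linarith
  rw [softMinMax]
  set Φ := logSumExp fun i => -δ * logSumExp fun j => β * x i j
  have hpos : 0 < β * δ := mul_pos hβ hδ
  have e : -(1 / (β * δ)) * Φ - m = (-Φ - δ * (β * m)) / (β * δ) := by field_simp
  rw [e, abs_le]
  constructor
  · refine (neg_le_neg (le_max_left _ _)).trans ?_
    rw [← neg_div]
    exact div_le_div_of_nonneg_right (by linarith) hpos.le
  · refine le_trans ?_ (le_max_right _ _)
    rw [div_le_div_iff₀ hpos hβ]
    nlinarith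

omit [Fintype ι] [Fintype κ] in
lemma hasDerivAt_line (x v : ι → κ → ℝ) (s : ℝ) (i : ι) (j : κ) :
    HasDerivAt (fun t : ℝ => (x + t • v) i j) (v i j) s := by
  simpa using ((hasDerivAt_id s).mul_const (v i j)).const_add (x i j)

omit [Fintype ι] in
lemma hasDerivAt_inner_logSumExp [Nonempty κ] (β δ : ℝ) (x v : ι → κ → ℝ) (s : ℝ) (i : ι) :
    HasDerivAt (fun t : ℝ => -δ * logSumExp fun j => β * (x + t • v) i j)
      (-δ * (β * ∑ j, innerWeight β (x + s • v) i j * v i j)) s := by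
  refine ((hasDerivAt_logSumExp fun j =>
    (hasDerivAt_line x v s i j).const_mul β).const_mul (-δ)).congr_deriv ?_
  congr 1
  rw [Finset.mul_sum]
  exact Finset.sum_congr rfl fun j _ => by rw [innerWeight]; ring

lemma hasDerivAt_softMinMax [Nonempty ι] [Nonempty κ] {β δ : ℝ} (hβ : 0 < β) (hδ : 0 < δ)
    (x v : ι → κ → ℝ) (s : ℝ) : HasDerivAt (fun t : ℝ => softMinMax β δ (x + t • v))
      (∑ i, ∑ j, minMaxWeight β δ (x + s • v) i j * v i j) s := by
  refine ((hasDerivAt_logSumExp fun i => hasDerivAt_inner_logSumExp β δ x v s i).const_mul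
    (-(1 / (β * δ)))).congr_deriv ?_
  rw [Finset.mul_sum]
  refine Finset.sum_congr rfl fun i _ => ?_
  simp only [minMaxWeight, mul_assoc, ← Finset.mul_sum]
  rw [← outerWeight]
  field_simp

omit [Fintype ι] in
lemma hasDerivAt_innerWeight [Nonempty κ] (β : ℝ) (x v : ι → κ → ℝ) (s : ℝ) (i : ι) (j : κ) :
    HasDerivAt (fun t : ℝ => innerWeight β (x + t • v) i j)
      (innerWeight β (x + s • v) i j *
        (β * (v i j - ∑ l, innerWeight β (x + s • v) i l * v i l))) s := by
  refine (hasDerivAt_softmax (fun j => (hasDerivAt_line x v s i j).const_mul β) j).congr_deriv ?_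
  change innerWeight β (x + s • v) i j * (β * v i j -
    ∑ l, innerWeight β (x + s • v) i l * (β * v i l)) = _
  simp only [mul_left_comm _ β, ← Finset.mul_sum, mul_sub]

lemma hasDerivAt_outerWeight [Nonempty ι] [Nonempty κ] (β δ : ℝ) (x v : ι → κ → ℝ) (s : ℝ)
    (i : ι) : HasDerivAt (fun t : ℝ => outerWeight β δ (x + t • v) i)
      (outerWeight β δ (x + s • v) i * (β * δ *
        (∑ k, ∑ l, minMaxWeight β δ (x + s • v) k l * v k l
          - ∑ l, innerWeight β (x + s • v) i l * v i l))) s := by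
  refine (hasDerivAt_softmax (fun i => hasDerivAt_inner_logSumExp β δ x v s i) i).congr_deriv ?_
  change outerWeight β δ (x + s • v) i *
    (-δ * (β * ∑ j, innerWeight β (x + s • v) i j * v i j) - ∑ k, outerWeight β δ (x + s • v) k *
      (-δ * (β * ∑ l, innerWeight β (x + s • v) k l * v k l))) = _
  have e : ∀ a b : ℝ, a * (-δ * (β * b)) = -δ * β * (a * b) := fun a b => by ring
  simp only [e, ← Finset.mul_sum]
  simp only [minMaxWeight, mul_assoc, ← Finset.mul_sum]
  ring

lemma hasDerivAt_minMaxWeight [DecidableEq ι] [DecidableEq κ] [Nonempty ι] [Nonempty κ]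
    (β δ : ℝ) (x v : ι → κ → ℝ) (s : ℝ)
    (i : ι) (j : κ) : HasDerivAt (fun t : ℝ => minMaxWeight β δ (x + t • v) i j)
      (∑ k, ∑ l, minMaxHessian β δ (x + s • v) i j k l * v k l) s := by
  refine ((hasDerivAt_outerWeight β δ x v s i).mul
    (hasDerivAt_innerWeight β x v s i j)).congr_deriv ?_
  simp only [minMaxHessian, mul_assoc, ← Finset.mul_sum, add_mul, sub_mul, Finset.sum_add_distrib,
    Finset.sum_sub_distrib, ite_mul, one_mul, zero_mul, Finset.sum_ite_irrel, Finset.sum_const_zero,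
    Finset.sum_ite_eq, Finset.mem_univ, if_true]
  rw [show minMaxWeight β δ (x + s • v) i j =
    outerWeight β δ (x + s • v) i * innerWeight β (x + s • v) i j from rfl]
  ring

lemma sum_abs_minMaxHessian_le [DecidableEq ι] [DecidableEq κ] [Nonempty ι] [Nonempty κ]
    {β δ : ℝ} (hβ : 0 < β) (hδ : 0 < δ)
    (x : ι → κ → ℝ) :
    ∑ i, ∑ j, ∑ k, ∑ l, |minMaxHessian β δ x i j k l| ≤ 2 * β * (1 + δ) := by
  calc ∑ i, ∑ j, ∑ k, ∑ l, |minMaxHessian β δ x i j k l|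
      ≤ ∑ i, ∑ j, ∑ k, ∑ l, β * (minMaxWeight β δ x i j *
        ((if i = k then if j = l then 1 else 0 else 0)
          + (1 + δ) * (if i = k then innerWeight β x i l else 0) + δ * minMaxWeight β δ x k l)) := by
        refine Finset.sum_le_sum fun i _ => Finset.sum_le_sum fun j _ => Finset.sum_le_sum fun k _ =>
          Finset.sum_le_sum fun l _ => ?_
        have h1 : (0 : ℝ) ≤ if i = k then if j = l then 1 else 0 else 0 := by
          split_ifs <;> norm_num
        have h2 : 0 ≤ (1 + δ) * (if i = k then innerWeight β x i l else 0) := by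
          refine mul_nonneg (by linarith) ?_
          split_ifs
          exacts [innerWeight_nonneg _ _ _ _, le_rfl]
        have h3 : 0 ≤ δ * minMaxWeight β δ x k l := mul_nonneg hδ.le (minMaxWeight_nonneg _ _ _ _ _)
        have h4 := minMaxWeight_nonneg β δ x i j
        rw [minMaxHessian, abs_mul, abs_of_nonneg (mul_nonneg hβ.le h4), mul_assoc]
        refine mul_le_mul_of_nonneg_left (mul_le_mul_of_nonneg_left ?_ h4) hβ.le
        rw [abs_le]
        constructor <;> linarith
    _ = 2 * β * (1 + δ) := by
        simp only [← Finset.mul_sum, Finset.sum_add_distrib, Finset.sum_ite_irrel,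
          Finset.sum_const_zero, Finset.sum_ite_eq, Finset.mem_univ, if_true, sum_innerWeight,
          sum_minMaxWeight, mul_one, ← Finset.sum_mul]
        ring

end SoftMinMax

section BoundedLipschitz

variable {ι κ : Type*} [Fintype ι] [Fintype κ]

/-- Bounded Lipschitz functions on matrices. -/
def IsBoundedLipschitz (u : (ι → κ → ℝ) → ℝ) : Prop :=
  ∃ A : ℝ, ∀ x y, |u x| ≤ A ∧ |u x - u y| ≤ A * ‖x - y‖

namespace IsBoundedLipschitz

lemma const (c : ℝ) : IsBoundedLipschitz fun _ : ι → κ → ℝ => c :=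
  ⟨|c|, fun x y => ⟨le_rfl, by simp; positivity⟩⟩

variable {u v : (ι → κ → ℝ) → ℝ}

lemma add (hu : IsBoundedLipschitz u) (hv : IsBoundedLipschitz v) :
    IsBoundedLipschitz fun x => u x + v x := by
  obtain ⟨A, hA⟩ := hu
  obtain ⟨B, hB⟩ := hv
  refine ⟨A + B, fun x y => ⟨(abs_add_le _ _).trans (add_le_add (hA x y).1 (hB x y).1), ?_⟩⟩
  rw [add_sub_add_comm, add_mul]
  exact (abs_add_le _ _).trans (add_le_add (hA x y).2 (hB x y).2)

lemma mul (hu : IsBoundedLipschitz u) (hv : IsBoundedLipschitz v) :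
    IsBoundedLipschitz fun x => u x * v x := by
  obtain ⟨A, hA⟩ := hu
  obtain ⟨B, hB⟩ := hv
  have hA0 : 0 ≤ A := (abs_nonneg _).trans (hA 0 0).1
  have hB0 : 0 ≤ B := (abs_nonneg _).trans (hB 0 0).1
  refine ⟨A * B + (A * B + A * B), fun x y => ⟨?_, ?_⟩⟩
  · rw [abs_mul]
    have := mul_le_mul (hA x y).1 (hB x y).1 (abs_nonneg _) hA0
    nlinarith [mul_nonneg hA0 hB0]
  · rw [show u x * v x - u y * v y = (u x - u y) * v x + u y * (v x - v y) by ring]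
    refine (abs_add_le _ _).trans ?_
    rw [abs_mul, abs_mul]
    have h1 := mul_le_mul (hA x y).2 (hB x y).1 (abs_nonneg _) (by positivity)
    have h2 := mul_le_mul (hA y x).1 (hB x y).2 (abs_nonneg _) hA0
    nlinarith [mul_nonneg (mul_nonneg hA0 hB0) (norm_nonneg (x - y))]

lemma comp_of_lipschitz {G : ℝ → ℝ} {F : (ι → κ → ℝ) → ℝ} {A B K : ℝ} (hA : ∀ t, |G t| ≤ A)
    (hB : ∀ s t, |G s - G t| ≤ B * |s - t|) (hF : ∀ x y, |F x - F y| ≤ K * ‖x - y‖) :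
    IsBoundedLipschitz fun x => G (F x) := by
  refine ⟨max A (|B| * K), fun x y => ⟨(hA _).trans (le_max_left _ _), ?_⟩⟩
  calc |G (F x) - G (F y)| ≤ B * |F x - F y| := hB _ _
    _ ≤ |B| * |F x - F y| := by gcongr; exact le_abs_self B
    _ ≤ |B| * (K * ‖x - y‖) := by gcongr; exact hF x y
    _ = |B| * K * ‖x - y‖ := by ring
    _ ≤ _ := by gcongr; exact le_max_right _ _

end IsBoundedLipschitz

lemma abs_apply_le_norm (v : ι → κ → ℝ) (i : ι) (j : κ) : |v i j| ≤ ‖v‖ :=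
  (norm_le_pi_norm (v i) j).trans (norm_le_pi_norm v i)

lemma abs_sum_mul_le (d : ι → κ → ℝ) (v : ι → κ → ℝ) :
    |∑ i, ∑ j, d i j * v i j| ≤ (∑ i, ∑ j, |d i j|) * ‖v‖ := by
  simp only [Finset.sum_mul]
  refine (Finset.abs_sum_le_sum_abs _ _).trans (Finset.sum_le_sum fun i _ => ?_)
  refine (Finset.abs_sum_le_sum_abs _ _).trans (Finset.sum_le_sum fun j _ => ?_)
  rw [abs_mul]
  exact mul_le_mul_of_nonneg_left (abs_apply_le_norm v i j) (abs_nonneg _)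

lemma abs_sub_le_of_line_deriv_le {u : (ι → κ → ℝ) → ℝ} {D : (ι → κ → ℝ) → (ι → κ → ℝ) → ℝ}
    {A : ℝ} (hd : ∀ x v s, HasDerivAt (fun t : ℝ => u (x + t • v)) (D (x + s • v) v) s)
    (hD : ∀ x v, |D x v| ≤ A * ‖v‖) (x y : ι → κ → ℝ) : |u x - u y| ≤ A * ‖x - y‖ := by
  have := Convex.norm_image_sub_le_of_norm_hasDerivWithin_le (s := Set.univ)
    (f := fun t : ℝ => u (y + t • (x - y))) (fun s _ => (hd y (x - y) s).hasDerivWithinAt)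
    (fun s _ => hD _ _) convex_univ (Set.mem_univ 0) (Set.mem_univ 1)
  simpa using this

/-- `u` has gradient `d`, in the sense of derivatives along lines. -/
def HasLineGradient (u : (ι → κ → ℝ) → ℝ) (d : (ι → κ → ℝ) → ι → κ → ℝ) : Prop :=
  ∀ (x v : ι → κ → ℝ) (s : ℝ),
    HasDerivAt (fun t : ℝ => u (x + t • v)) (∑ i, ∑ j, d (x + s • v) i j * v i j) s

lemma taylor_two_remainder_le {φ φ₁ φ₂ : ℝ → ℝ} {K : ℝ} (h1 : ∀ s, HasDerivAt φ (φ₁ s) s)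
    (h2 : ∀ s, HasDerivAt φ₁ (φ₂ s) s) (hK : ∀ s ∈ Set.Icc (0 : ℝ) 1, |φ₂ s - φ₂ 0| ≤ K) :
    |φ 1 - φ 0 - φ₁ 0 - φ₂ 0 / 2| ≤ K := by
  have hb : ∀ s ∈ Set.Icc (0 : ℝ) 1, |φ₁ s - φ₁ 0 - φ₂ 0 * s| ≤ K := by
    intro s hs
    have hK0 : 0 ≤ K := (abs_nonneg _).trans (hK s hs)
    have := Convex.norm_image_sub_le_of_norm_hasDerivWithin_le (s := Set.Icc (0 : ℝ) 1)
      (f := fun t : ℝ => φ₁ t - φ₂ 0 * t)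
      (fun s _ => ((h2 s).sub ((hasDerivAt_id s).const_mul (φ₂ 0))).hasDerivWithinAt)
      (C := K) (fun s hs => by simpa using hK s hs) (convex_Icc 0 1)
      (Set.left_mem_Icc.2 zero_le_one) hs
    simp only [Real.norm_eq_abs, mul_zero, sub_zero] at this
    rw [abs_of_nonneg hs.1] at this
    rw [show φ₁ s - φ₁ 0 - φ₂ 0 * s = φ₁ s - φ₂ 0 * s - φ₁ 0 by ring]
    exact this.trans (mul_le_of_le_one_right hK0 hs.2)
  have := Convex.norm_image_sub_le_of_norm_hasDerivWithin_le (s := Set.Icc (0 : ℝ) 1)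
    (f := fun t : ℝ => φ t - φ₁ 0 * t - φ₂ 0 / 2 * t ^ 2)
    (f' := fun s => φ₁ s - φ₁ 0 - φ₂ 0 * s)
    (fun s _ => by
      refine HasDerivAt.hasDerivWithinAt ?_
      refine (((h1 s).sub ((hasDerivAt_id s).const_mul (φ₁ 0))).sub
        ((hasDerivAt_pow 2 s).const_mul (φ₂ 0 / 2))).congr_deriv ?_
      simp only [Nat.cast_ofNat, Nat.add_one_sub_one, pow_one, mul_one]
      ring)
    (C := K) hb (convex_Icc 0 1) (Set.left_mem_Icc.2 zero_le_one) (Set.right_mem_Icc.2 zero_le_one)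
  simp only [Real.norm_eq_abs, mul_zero, sub_zero, mul_one, ne_eq, OfNat.ofNat_ne_zero,
    not_false_eq_true, zero_pow, one_pow, abs_one] at this
  rwa [show φ 1 - φ 0 - φ₁ 0 - φ₂ 0 / 2 = φ 1 - φ₁ 0 - φ₂ 0 / 2 - φ 0 by ring]

lemma exists_taylor_bound {f : (ι → κ → ℝ) → ℝ} {d : (ι → κ → ℝ) → ι → κ → ℝ}
    {H : (ι → κ → ℝ) → ι → κ → ι → κ → ℝ} (hf : HasLineGradient f d)
    (hd : ∀ i j, HasLineGradient (fun x => d x i j) (fun x => H x i j))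
    (hH : ∀ i j k l, IsBoundedLipschitz fun x => H x i j k l) :
    ∃ K, 0 ≤ K ∧ ∀ x v, |f (x + v) - f x - ∑ i, ∑ j, d x i j * v i j
      - (∑ i, ∑ j, (∑ k, ∑ l, H x i j k l * v k l) * v i j) / 2| ≤ K * ‖v‖ ^ 3 := by
  choose A hA using hH
  have hA0 : ∀ i j k l, 0 ≤ A i j k l := fun i j k l => (abs_nonneg _).trans (hA i j k l 0 0).1
  refine ⟨∑ i, ∑ j, ∑ k, ∑ l, A i j k l, Finset.sum_nonneg fun i _ => Finset.sum_nonneg fun j _ =>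
    Finset.sum_nonneg fun k _ => Finset.sum_nonneg fun l _ => hA0 i j k l, fun x v => ?_⟩
  have h2 : ∀ s, HasDerivAt (fun s : ℝ => ∑ i, ∑ j, d (x + s • v) i j * v i j)
      (∑ i, ∑ j, (∑ k, ∑ l, H (x + s • v) i j k l * v k l) * v i j) s := fun s =>
    HasDerivAt.fun_sum fun i _ => HasDerivAt.fun_sum fun j _ => (hd i j x v s).mul_const _
  have := taylor_two_remainder_le (K := (∑ i, ∑ j, ∑ k, ∑ l, A i j k l) * ‖v‖ ^ 3)
    (hf x v) h2 ?_
  · simpa using this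
  intro s hs
  simp only [zero_smul, add_zero, ← Finset.sum_sub_distrib, ← sub_mul]
  refine (abs_sum_mul_le _ v).trans ?_
  rw [pow_succ ‖v‖ 2, ← mul_assoc]
  refine mul_le_mul_of_nonneg_right ?_ (norm_nonneg v)
  simp only [Finset.sum_mul]
  refine Finset.sum_le_sum fun i _ => Finset.sum_le_sum fun j _ => ?_
  refine (abs_sum_mul_le _ v).trans ?_
  rw [sq]
  simp only [← Finset.sum_mul]
  rw [← mul_assoc]
  refine mul_le_mul_of_nonneg_right ?_ (norm_nonneg v)
  simp only [Finset.sum_mul]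
  refine Finset.sum_le_sum fun k _ => Finset.sum_le_sum fun l _ => ?_
  refine (hA i j k l (x + s • v) x).2.trans ?_
  refine mul_le_mul_of_nonneg_left ?_ (hA0 i j k l)
  rw [add_sub_cancel_left, norm_smul, Real.norm_eq_abs, abs_of_nonneg hs.1]
  exact mul_le_of_le_one_left (norm_nonneg v) hs.2

end BoundedLipschitz

section SmoothedFunctional

variable {ι κ : Type*} [Fintype ι] [Fintype κ] [Nonempty ι] [Nonempty κ]

lemma abs_softMinMax_sub_softMinMax_le {β δ : ℝ} (hβ : 0 < β) (hδ : 0 < δ) (x y : ι → κ → ℝ) :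
    |softMinMax β δ x - softMinMax β δ y| ≤ 1 * ‖x - y‖ := by
  refine abs_sub_le_of_line_deriv_le (D := fun x v => ∑ i, ∑ j, minMaxWeight β δ x i j * v i j)
    (hasDerivAt_softMinMax hβ hδ) (fun x v => (abs_sum_mul_le _ v).trans (le_of_eq ?_)) x y
  simp only [abs_of_nonneg (minMaxWeight_nonneg β δ x _ _), sum_minMaxWeight]

lemma continuous_softMinMax {β δ : ℝ} (hβ : 0 < β) (hδ : 0 < δ) :
    Continuous (softMinMax β δ : (ι → κ → ℝ) → ℝ) :=
  (LipschitzWith.of_dist_le_mul (K := 1) fun x y => by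
    simpa [dist_eq_norm] using abs_softMinMax_sub_softMinMax_le hβ hδ x y).continuous

omit [Nonempty ι] [Fintype ι] in
lemma innerWeight_le_one (β : ℝ) (x : ι → κ → ℝ) (i : ι) (j : κ) : innerWeight β x i j ≤ 1 := by
  rw [← sum_innerWeight β x i]
  exact Finset.single_le_sum (fun j _ => innerWeight_nonneg β x i j) (Finset.mem_univ j)

lemma minMaxWeight_le_one (β δ : ℝ) (x : ι → κ → ℝ) (i : ι) (j : κ) :
    minMaxWeight β δ x i j ≤ 1 := by
  rw [← sum_minMaxWeight β δ x]
  exact (Finset.single_le_sum (fun j _ => minMaxWeight_nonneg β δ x i j) (Finset.mem_univ j)).trans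
    (Finset.single_le_sum (f := fun i => ∑ j, minMaxWeight β δ x i j)
      (fun i _ => Finset.sum_nonneg fun j _ => minMaxWeight_nonneg β δ x i j) (Finset.mem_univ i))

omit [Nonempty ι] in
lemma isBoundedLipschitz_innerWeight {β : ℝ} (hβ : 0 < β) (i : ι) (j : κ) :
    IsBoundedLipschitz fun x : ι → κ → ℝ => innerWeight β x i j := by
  have hL : ∀ x y : ι → κ → ℝ, |innerWeight β x i j - innerWeight β y i j| ≤ 2 * β * ‖x - y‖ := by
    refine abs_sub_le_of_line_deriv_le (D := fun x v => innerWeight β x i j *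
      (β * (v i j - ∑ l, innerWeight β x i l * v i l)))
      (fun x v s => hasDerivAt_innerWeight β x v s i j) fun x v => ?_
    have h1 := abs_apply_le_norm v i j
    have h2 : |∑ l, innerWeight β x i l * v i l| ≤ ‖v‖ := by
      calc |∑ l, innerWeight β x i l * v i l| ≤ ∑ l, innerWeight β x i l * ‖v‖ := by
            refine (Finset.abs_sum_le_sum_abs _ _).trans (Finset.sum_le_sum fun l _ => ?_)
            rw [abs_mul, abs_of_nonneg (innerWeight_nonneg _ _ _ _)]
            exact mul_le_mul_of_nonneg_left (abs_apply_le_norm v i l) (innerWeight_nonneg _ _ _ _)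
        _ = ‖v‖ := by rw [← Finset.sum_mul, sum_innerWeight, one_mul]
    rw [abs_mul, abs_mul, abs_of_nonneg (innerWeight_nonneg _ _ _ _), abs_of_pos hβ]
    calc innerWeight β x i j * (β * |v i j - ∑ l, innerWeight β x i l * v i l|)
        ≤ 1 * (β * (‖v‖ + ‖v‖)) := by
          gcongr
          · exact innerWeight_le_one _ _ _ _
          · exact (abs_sub _ _).trans (add_le_add h1 h2)
      _ = 2 * β * ‖v‖ := by ring
  refine ⟨max 1 (2 * β), fun x y => ⟨?_, (hL x y).trans ?_⟩⟩
  · rw [abs_of_nonneg (innerWeight_nonneg _ _ _ _)]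
    exact (innerWeight_le_one _ _ _ _).trans (le_max_left _ _)
  · gcongr
    exact le_max_right _ _

variable [DecidableEq ι] [DecidableEq κ]

lemma isBoundedLipschitz_minMaxWeight {β δ : ℝ} (hβ : 0 < β) (hδ : 0 < δ) (i : ι) (j : κ) :
    IsBoundedLipschitz fun x : ι → κ → ℝ => minMaxWeight β δ x i j := by
  have hL : ∀ x y : ι → κ → ℝ, |minMaxWeight β δ x i j - minMaxWeight β δ y i j| ≤
      2 * β * (1 + δ) * ‖x - y‖ := by
    refine abs_sub_le_of_line_deriv_le
      (D := fun x v => ∑ k, ∑ l, minMaxHessian β δ x i j k l * v k l)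
      (fun x v s => hasDerivAt_minMaxWeight β δ x v s i j) fun x v => ?_
    refine (abs_sum_mul_le _ v).trans (mul_le_mul_of_nonneg_right ?_ (norm_nonneg v))
    refine le_trans ?_ (sum_abs_minMaxHessian_le hβ hδ x)
    have h0 : ∀ i j, 0 ≤ ∑ k, ∑ l, |minMaxHessian β δ x i j k l| := fun i j =>
      Finset.sum_nonneg fun k _ => Finset.sum_nonneg fun l _ => abs_nonneg _
    exact (Finset.single_le_sum (fun j _ => h0 i j) (Finset.mem_univ j)).trans
      (Finset.single_le_sum (f := fun i => ∑ j, ∑ k, ∑ l, |minMaxHessian β δ x i j k l|)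
        (fun i _ => Finset.sum_nonneg fun j _ => h0 i j) (Finset.mem_univ i))
  refine ⟨max 1 (2 * β * (1 + δ)), fun x y => ⟨?_, (hL x y).trans ?_⟩⟩
  · rw [abs_of_nonneg (minMaxWeight_nonneg _ _ _ _ _)]
    exact (minMaxWeight_le_one _ _ _ _ _).trans (le_max_left _ _)
  · gcongr
    exact le_max_right _ _

lemma isBoundedLipschitz_minMaxHessian {β δ : ℝ} (hβ : 0 < β) (hδ : 0 < δ) (i : ι) (j : κ)
    (k : ι) (l : κ) : IsBoundedLipschitz fun x : ι → κ → ℝ => minMaxHessian β δ x i j k l := by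
  simp only [minMaxHessian, sub_eq_add_neg, ← neg_mul]
  refine ((IsBoundedLipschitz.const β).mul (isBoundedLipschitz_minMaxWeight hβ hδ i j)).mul
    (((IsBoundedLipschitz.const _).add ((IsBoundedLipschitz.const _).mul ?_)).add
      ((IsBoundedLipschitz.const _).mul (isBoundedLipschitz_minMaxWeight hβ hδ k l)))
  split_ifs
  · exact isBoundedLipschitz_innerWeight hβ i l
  · exact IsBoundedLipschitz.const 0

/-- The Hessian of `G ∘ softMinMax β δ`, in terms of the derivatives `G₁, G₂` of `G`. -/
noncomputable def compHessian (G₁ G₂ : ℝ → ℝ) (β δ : ℝ) (x : ι → κ → ℝ) (i : ι) (j : κ) (k : ι)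
    (l : κ) : ℝ :=
  G₂ (softMinMax β δ x) * (minMaxWeight β δ x i j * minMaxWeight β δ x k l)
    + G₁ (softMinMax β δ x) * minMaxHessian β δ x i j k l

omit [DecidableEq ι] [DecidableEq κ] in
lemma hasLineGradient_comp {G G₁ : ℝ → ℝ} (hG : ∀ t, HasDerivAt G (G₁ t) t) {β δ : ℝ}
    (hβ : 0 < β) (hδ : 0 < δ) :
    HasLineGradient (fun x : ι → κ → ℝ => G (softMinMax β δ x))
      (fun x i j => G₁ (softMinMax β δ x) * minMaxWeight β δ x i j) := by
  intro x v s
  refine ((hG _).comp s (hasDerivAt_softMinMax hβ hδ x v s)).congr_deriv ?_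
  simp only [mul_assoc, ← Finset.mul_sum]

lemma hasLineGradient_comp_gradient {G₁ G₂ : ℝ → ℝ} (hG : ∀ t, HasDerivAt G₁ (G₂ t) t) {β δ : ℝ}
    (hβ : 0 < β) (hδ : 0 < δ) (i : ι) (j : κ) :
    HasLineGradient (fun x : ι → κ → ℝ => G₁ (softMinMax β δ x) * minMaxWeight β δ x i j)
      (fun x => compHessian G₁ G₂ β δ x i j) := by
  intro x v s
  refine (((hG _).comp s (hasDerivAt_softMinMax hβ hδ x v s)).mul
    (hasDerivAt_minMaxWeight β δ x v s i j)).congr_deriv ?_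
  simp only [compHessian, add_mul, mul_assoc, Finset.sum_add_distrib, ← Finset.mul_sum,
    Function.comp_apply]
  ring

lemma isBoundedLipschitz_compHessian {G₁ G₂ : ℝ → ℝ} (hG : ∀ t, HasDerivAt G₁ (G₂ t) t)
    {a b K : ℝ} (hG₁ : ∀ t, |G₁ t| ≤ a) (hG₂ : ∀ t, |G₂ t| ≤ b)
    (hK : ∀ s t, |G₂ s - G₂ t| ≤ K * |s - t|) {β δ : ℝ} (hβ : 0 < β) (hδ : 0 < δ)
    (i : ι) (j : κ) (k : ι) (l : κ) :
    IsBoundedLipschitz fun x : ι → κ → ℝ => compHessian G₁ G₂ β δ x i j k l := by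
  have hlip : ∀ s t, |G₁ s - G₁ t| ≤ b * |s - t| := fun s t =>
    Convex.norm_image_sub_le_of_norm_hasDerivWithin_le (s := Set.univ)
      (fun s _ => (hG s).hasDerivWithinAt) (fun s _ => hG₂ s) convex_univ (Set.mem_univ t)
      (Set.mem_univ s)
  have hF := abs_softMinMax_sub_softMinMax_le hβ hδ (ι := ι) (κ := κ)
  exact ((IsBoundedLipschitz.comp_of_lipschitz hG₂ hK hF).mul
    ((isBoundedLipschitz_minMaxWeight hβ hδ i j).mul
      (isBoundedLipschitz_minMaxWeight hβ hδ k l))).add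
    ((IsBoundedLipschitz.comp_of_lipschitz hG₁ hlip hF).mul
      (isBoundedLipschitz_minMaxHessian hβ hδ i j k l))

lemma sum_abs_compHessian_le {G₁ G₂ : ℝ → ℝ} {a b : ℝ} (hG₁ : ∀ t, |G₁ t| ≤ a)
    (hG₂ : ∀ t, |G₂ t| ≤ b) {β δ : ℝ} (hβ : 0 < β) (hδ : 0 < δ) (x : ι → κ → ℝ) :
    ∑ i, ∑ j, ∑ k, ∑ l, |compHessian G₁ G₂ β δ x i j k l| ≤ b + a * (2 * β * (1 + δ)) := by
  have ha : 0 ≤ a := (abs_nonneg _).trans (hG₁ 0)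
  calc ∑ i, ∑ j, ∑ k, ∑ l, |compHessian G₁ G₂ β δ x i j k l|
      ≤ ∑ i, ∑ j, ∑ k, ∑ l, (b * (minMaxWeight β δ x i j * minMaxWeight β δ x k l)
          + a * |minMaxHessian β δ x i j k l|) := by
        refine Finset.sum_le_sum fun i _ => Finset.sum_le_sum fun j _ => Finset.sum_le_sum fun k _ =>
          Finset.sum_le_sum fun l _ => ?_
        have hw := mul_nonneg (minMaxWeight_nonneg β δ x i j) (minMaxWeight_nonneg β δ x k l)
        refine (abs_add_le _ _).trans (add_le_add ?_ ?_)
        · rw [abs_mul, abs_of_nonneg hw]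
          exact mul_le_mul_of_nonneg_right (hG₂ _) hw
        · rw [abs_mul]
          exact mul_le_mul_of_nonneg_right (hG₁ _) (abs_nonneg _)
    _ = b + a * ∑ i, ∑ j, ∑ k, ∑ l, |minMaxHessian β δ x i j k l| := by
        simp only [Finset.sum_add_distrib, ← Finset.mul_sum, sum_minMaxWeight, mul_one]
    _ ≤ _ := by
        gcongr
        exact sum_abs_minMaxHessian_le hβ hδ x

end SmoothedFunctional

section GaussianComparison

variable {ι κ : Type*} [Fintype ι] [Fintype κ]

lemma integral_gaussian_split {E : Type*} [NormedAddCommGroup E] [NormedSpace ℝ E]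
    [SecondCountableTopology E] [CompleteSpace E] [MeasurableSpace E] [BorelSpace E]
    (μ : Measure E) [IsGaussian μ] (hμ : ∀ L : StrongDual ℝ E, μ[L] = 0) {f : E → ℝ}
    (hf : Continuous f) {a b : ℝ} (ha : 0 ≤ a) (hb : 0 ≤ b) {A : ℝ} (hA : ∀ x, |f x| ≤ A) :
    ∫ x, f (√(a + b) • x) ∂μ = ∫ x, ∫ y, f (√a • x + √b • y) ∂μ ∂μ := by
  rcases (add_nonneg ha hb).eq_or_lt with h | h
  · obtain rfl : a = 0 := by linarith
    obtain rfl : b = 0 := by linarith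
    simp
  set θ := arccos (√(a / (a + b)))
  have hle : a / (a + b) ≤ 1 := (div_le_one h).2 (by linarith)
  have hcos : cos θ = √a / √(a + b) := by
    rw [cos_arccos (by linarith [sqrt_nonneg (a / (a + b))]) (sqrt_le_one.2 hle), sqrt_div ha]
  have hsin : sin θ = √b / √(a + b) := by
    rw [sin_arccos, sq_sqrt (by positivity), ← sqrt_div hb]
    congr 1
    field_simp
    ring
  have hs : √(a + b) ≠ 0 := (sqrt_pos.2 h).ne'
  have h_int : Integrable (fun p : E × E => f (√a • p.1 + √b • p.2)) (μ.prod μ) := by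
    refine Integrable.of_bound (by fun_prop) A (Filter.Eventually.of_forall fun p => hA _)
  rw [← integral_prod (fun p : E × E => f (√a • p.1 + √b • p.2)) h_int]
  have h1 : ∫ x, f (√(a + b) • x) ∂μ = ∫ p : E × E, f (√(a + b) • p.1) ∂(μ.prod μ) := by
    rw [integral_fun_fst (f := fun x => f (√(a + b) • x))]
    simp
  rw [h1, ← IsGaussian.map_rotation_eq_self_of_forall_strongDual_eq_zero hμ θ,
    integral_map (by fun_prop) (by fun_prop),
    IsGaussian.map_rotation_eq_self_of_forall_strongDual_eq_zero hμ θ]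
  congr 1 with p
  rw [ContinuousLinearMap.rotation_apply]
  simp only [smul_add, smul_smul, hcos, hsin, mul_div_cancel₀ _ hs]

lemma abs_interpolation_step_le {E : Type*} [NormedAddCommGroup E] [NormedSpace ℝ E]
    [SecondCountableTopology E] [CompleteSpace E] [MeasurableSpace E] [BorelSpace E]
    (μ ν : Measure E) [IsGaussian μ] [IsGaussian ν] (hμ : ∀ L : StrongDual ℝ E, μ[L] = 0)
    (hν : ∀ L : StrongDual ℝ E, ν[L] = 0) {f : E → ℝ} (hf : Continuous f) {A : ℝ}
    (hA : ∀ x, |f x| ≤ A) {a b h ε : ℝ} (ha : 0 ≤ a) (hb : 0 ≤ b) (hh : 0 ≤ h)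
    (hε : ∀ c, |∫ z, f (c + √h • z) ∂μ - ∫ z, f (c + √h • z) ∂ν| ≤ ε) :
    |∫ p : E × E, f (√(a + h) • p.1 + √b • p.2) ∂(μ.prod ν)
      - ∫ p : E × E, f (√a • p.1 + √(b + h) • p.2) ∂(μ.prod ν)| ≤ ε := by
  have h_int : ∀ s t : ℝ, Integrable (fun p : E × E => f (s • p.1 + t • p.2)) (μ.prod ν) :=
    fun s t => Integrable.of_bound (by fun_prop) A (Filter.Eventually.of_forall fun p => hA _)
  have hmeas : ∀ ρ : Measure E, IsProbabilityMeasure ρ → Integrable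
      (fun p : E × E => ∫ z, f (√a • p.1 + √b • p.2 + √h • z) ∂ρ) (μ.prod ν) := by
    intro ρ hρ
    refine Integrable.of_bound ?_ A (Filter.Eventually.of_forall fun p => ?_)
    · have : Continuous fun q : (E × E) × E => f (√a • q.1.1 + √b • q.1.2 + √h • q.2) := by
        fun_prop
      exact this.stronglyMeasurable.integral_prod_right.aestronglyMeasurable
    · refine (norm_integral_le_of_norm_le_const (C := A)
        (Filter.Eventually.of_forall fun z => hA _)).trans (by simp)
  have h1 : ∫ p : E × E, f (√(a + h) • p.1 + √b • p.2) ∂(μ.prod ν)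
      = ∫ p : E × E, ∫ z, f (√a • p.1 + √b • p.2 + √h • z) ∂μ ∂(μ.prod ν) := by
    rw [integral_prod_symm _ (h_int _ _), integral_prod_symm _ (hmeas μ inferInstance)]
    congr 1 with y
    rw [integral_gaussian_split μ hμ (f := fun x => f (x + √b • y)) (by fun_prop) ha hh
      (fun x => hA _)]
    simp only [add_right_comm]
  have h2 : ∫ p : E × E, f (√a • p.1 + √(b + h) • p.2) ∂(μ.prod ν)
      = ∫ p : E × E, ∫ z, f (√a • p.1 + √b • p.2 + √h • z) ∂ν ∂(μ.prod ν) := by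
    rw [integral_prod _ (h_int _ _), integral_prod _ (hmeas ν inferInstance)]
    congr 1 with x
    rw [integral_gaussian_split ν hν (f := fun y => f (√a • x + y)) (by fun_prop) hb hh
      (fun x => hA _)]
    simp only [add_assoc]
  rw [h1, h2, ← integral_sub (hmeas μ inferInstance) (hmeas ν inferInstance)]
  rw [← Real.norm_eq_abs]
  refine (norm_integral_le_of_norm_le_const (C := ε) (μ := μ.prod ν)
    (f := fun p : E × E => ∫ z, f (√a • p.1 + √b • p.2 + √h • z) ∂μ
      - ∫ z, f (√a • p.1 + √b • p.2 + √h • z) ∂ν)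
    (Filter.Eventually.of_forall fun p => hε (√a • p.1 + √b • p.2))).trans (by simp)

/-- Lindeberg replacement: a Gaussian measure is an `N`-fold convolution of rescaled copies. -/
lemma abs_integral_sub_le_of_forall_step {E : Type*} [NormedAddCommGroup E] [NormedSpace ℝ E]
    [SecondCountableTopology E] [CompleteSpace E] [MeasurableSpace E] [BorelSpace E]
    (μ ν : Measure E) [IsGaussian μ] [IsGaussian ν] (hμ : ∀ L : StrongDual ℝ E, μ[L] = 0)
    (hν : ∀ L : StrongDual ℝ E, ν[L] = 0) {f : E → ℝ} (hf : Continuous f) {A : ℝ}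
    (hA : ∀ x, |f x| ≤ A) {N : ℕ} (hN : 0 < N) {ε : ℝ}
    (hε : ∀ c, |∫ z, f (c + √(1 / N) • z) ∂μ - ∫ z, f (c + √(1 / N) • z) ∂ν| ≤ ε) :
    |∫ x, f x ∂μ - ∫ x, f x ∂ν| ≤ N * ε := by
  have hN' : (0 : ℝ) < N := by exact_mod_cast hN
  set Φ : ℕ → ℝ := fun k =>
    ∫ p : E × E, f (√(k / N) • p.1 + √((N - k) / N) • p.2) ∂(μ.prod ν) with hΦ
  have hstep : ∀ k < N, dist (Φ k) (Φ (k + 1)) ≤ ε := by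
    intro k hk
    have hk' : (k : ℝ) + 1 ≤ N := by exact_mod_cast hk
    have := abs_interpolation_step_le μ ν hμ hν hf hA (a := k / N) (b := (N - (k + 1)) / N)
      (h := 1 / N) (by positivity) (div_nonneg (by linarith) hN'.le) (by positivity) hε
    rw [← add_div, ← add_div, sub_add_eq_add_sub, add_sub_add_right_eq_sub] at this
    rw [dist_comm, Real.dist_eq, hΦ]
    push_cast
    exact this
  have hsum := dist_le_range_sum_of_dist_le (f := Φ) N (d := fun _ => ε) (fun {k} hk => hstep k hk)
  have h0 : Φ 0 = ∫ x, f x ∂ν := by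
    simp only [hΦ, CharP.cast_eq_zero, zero_div, sqrt_zero, zero_smul, zero_add, sub_zero,
      div_self hN'.ne', sqrt_one, one_smul]
    rw [integral_fun_snd]
    simp
  have h1 : Φ N = ∫ x, f x ∂μ := by
    simp only [hΦ, sub_self, zero_div, sqrt_zero, zero_smul, add_zero, div_self hN'.ne', sqrt_one,
      one_smul]
    rw [integral_fun_fst]
    simp
  rw [dist_comm, Real.dist_eq, h0, h1] at hsum
  simpa using hsum

lemma integrable_apply (μ : Measure (ι → κ → ℝ)) [IsGaussian μ] (i : ι) (j : κ) :
    Integrable (fun x : ι → κ → ℝ => x i j) μ :=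
  (IsGaussian.integrable_dual μ
    ((ContinuousLinearMap.proj j).comp
      (ContinuousLinearMap.proj (R := ℝ) (φ := fun _ : ι => κ → ℝ) i)))

lemma integrable_apply_mul_apply (μ : Measure (ι → κ → ℝ)) [IsGaussian μ] (i : ι) (j : κ)
    (k : ι) (l : κ) : Integrable (fun x : ι → κ → ℝ => x i j * x k l) μ := by
  have h : ∀ i j, MemLp (fun x : ι → κ → ℝ => x i j) 2 μ := fun i j =>
    (IsGaussian.memLp_dual μ ((ContinuousLinearMap.proj j).comp
      (ContinuousLinearMap.proj (R := ℝ) (φ := fun _ : ι => κ → ℝ) i)) 2 (by simp))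
  exact (h i j).integrable_mul (h k l)

lemma integrable_norm_pow_three (μ : Measure (ι → κ → ℝ)) [IsGaussian μ] :
    Integrable (fun x : ι → κ → ℝ => ‖x‖ ^ 3) μ :=
  (IsGaussian.memLp_id μ 3 (by simp)).integrable_norm_pow (by simp)

lemma exists_taylor_integral_bound {f : (ι → κ → ℝ) → ℝ} {d : (ι → κ → ℝ) → ι → κ → ℝ}
    {H : (ι → κ → ℝ) → ι → κ → ι → κ → ℝ} (hf : HasLineGradient f d)
    (hd : ∀ i j, HasLineGradient (fun x => d x i j) (fun x => H x i j))
    (hH : ∀ i j k l, IsBoundedLipschitz fun x => H x i j k l) (hfc : Continuous f) {A : ℝ}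
    (hA : ∀ x, |f x| ≤ A) (μ : Measure (ι → κ → ℝ)) [IsGaussian μ]
    (hμ : ∀ i j, ∫ x, x i j ∂μ = 0) :
    ∃ M, ∀ c s, 0 ≤ s → |∫ x, f (c + s • x) ∂μ - (f c + s ^ 2 / 2 *
      ∑ i, ∑ j, ∑ k, ∑ l, H c i j k l * ∫ x, x k l * x i j ∂μ)| ≤ M * s ^ 3 := by
  obtain ⟨K, hK0, hK⟩ := exists_taylor_bound hf hd hH
  refine ⟨K * ∫ x, ‖x‖ ^ 3 ∂μ, fun c s hs => ?_⟩
  have i1 : Integrable (fun x : ι → κ → ℝ => ∑ i, ∑ j, d c i j * x i j) μ :=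
    integrable_finsetSum _ fun i _ => integrable_finsetSum _ fun j _ =>
      (integrable_apply μ i j).const_mul _
  have i2 : Integrable
      (fun x : ι → κ → ℝ => ∑ i, ∑ j, ∑ k, ∑ l, H c i j k l * (x k l * x i j)) μ :=
    integrable_finsetSum _ fun i _ => integrable_finsetSum _ fun j _ =>
      integrable_finsetSum _ fun k _ => integrable_finsetSum _ fun l _ =>
        (integrable_apply_mul_apply μ k l i j).const_mul _
  have e1 : ∫ x, ∑ i, ∑ j, d c i j * x i j ∂μ = 0 := by
    rw [integral_finsetSum _ fun i _ => integrable_finsetSum _ fun j _ =>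
      (integrable_apply μ i j).const_mul _]
    refine Finset.sum_eq_zero fun i _ => ?_
    rw [integral_finsetSum _ fun j _ => (integrable_apply μ i j).const_mul _]
    refine Finset.sum_eq_zero fun j _ => ?_
    rw [integral_const_mul, hμ, mul_zero]
  have e2 : ∫ x, ∑ i, ∑ j, ∑ k, ∑ l, H c i j k l * (x k l * x i j) ∂μ
      = ∑ i, ∑ j, ∑ k, ∑ l, H c i j k l * ∫ x, x k l * x i j ∂μ := by
    rw [integral_finsetSum _ fun i _ => integrable_finsetSum _ fun j _ =>
      integrable_finsetSum _ fun k _ => integrable_finsetSum _ fun l _ =>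
        (integrable_apply_mul_apply μ k l i j).const_mul _]
    refine Finset.sum_congr rfl fun i _ => ?_
    rw [integral_finsetSum _ fun j _ => integrable_finsetSum _ fun k _ =>
      integrable_finsetSum _ fun l _ => (integrable_apply_mul_apply μ k l i j).const_mul _]
    refine Finset.sum_congr rfl fun j _ => ?_
    rw [integral_finsetSum _ fun k _ =>
      integrable_finsetSum _ fun l _ => (integrable_apply_mul_apply μ k l i j).const_mul _]
    refine Finset.sum_congr rfl fun k _ => ?_
    rw [integral_finsetSum _ fun l _ => (integrable_apply_mul_apply μ k l i j).const_mul _]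
    exact Finset.sum_congr rfl fun l _ => integral_const_mul _ _
  have i0 : Integrable (fun x => f (c + s • x)) μ :=
    Integrable.of_bound (by fun_prop) A (Filter.Eventually.of_forall fun p => hA _)
  have i01 : Integrable (fun x => f c + s * ∑ i, ∑ j, d c i j * x i j) μ :=
    (integrable_const _).add (i1.const_mul s)
  have iT : Integrable (fun x => f c + s * (∑ i, ∑ j, d c i j * x i j) + s ^ 2 / 2 *
      ∑ i, ∑ j, ∑ k, ∑ l, H c i j k l * (x k l * x i j)) μ :=
    i01.add (i2.const_mul _)
  have eT : ∫ x, (f c + s * (∑ i, ∑ j, d c i j * x i j) + s ^ 2 / 2 *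
      ∑ i, ∑ j, ∑ k, ∑ l, H c i j k l * (x k l * x i j)) ∂μ = f c + s ^ 2 / 2 *
      ∑ i, ∑ j, ∑ k, ∑ l, H c i j k l * ∫ x, x k l * x i j ∂μ := by
    rw [integral_add i01 (i2.const_mul _),
      integral_add (integrable_const _) (i1.const_mul s), integral_const_mul, integral_const_mul,
      e1, e2]
    simp
  rw [← eT, ← integral_sub i0 iT]
  calc |∫ x, (f (c + s • x) - (f c + s * (∑ i, ∑ j, d c i j * x i j) + s ^ 2 / 2 *
      ∑ i, ∑ j, ∑ k, ∑ l, H c i j k l * (x k l * x i j))) ∂μ|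
      ≤ ∫ x, K * s ^ 3 * ‖x‖ ^ 3 ∂μ := by
        rw [← Real.norm_eq_abs]
        refine norm_integral_le_of_norm_le ((integrable_norm_pow_three μ).const_mul _)
          (Filter.Eventually.of_forall fun x => ?_)
        have h := hK c (s • x)
        rw [norm_smul, Real.norm_eq_abs, abs_of_nonneg hs, mul_pow, ← mul_assoc] at h
        rw [Real.norm_eq_abs]
        refine le_trans (le_of_eq ?_) h
        congr 1
        have a1 : ∑ i, ∑ j, d c i j * (s • x) i j = s * ∑ i, ∑ j, d c i j * x i j := by
          simp only [Finset.mul_sum, Pi.smul_apply, smul_eq_mul]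
          exact Finset.sum_congr rfl fun i _ => Finset.sum_congr rfl fun j _ => by ring
        have a2 : ∑ i, ∑ j, (∑ k, ∑ l, H c i j k l * (s • x) k l) * (s • x) i j
            = s ^ 2 * ∑ i, ∑ j, ∑ k, ∑ l, H c i j k l * (x k l * x i j) := by
          simp only [Finset.mul_sum, Finset.sum_mul, Pi.smul_apply, smul_eq_mul]
          exact Finset.sum_congr rfl fun i _ => Finset.sum_congr rfl fun j _ =>
            Finset.sum_congr rfl fun k _ => Finset.sum_congr rfl fun l _ => by ring
        rw [a1, a2]
        ring
    _ = K * (∫ x, ‖x‖ ^ 3 ∂μ) * s ^ 3 := by rw [integral_const_mul]; ring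

lemma abs_integral_sub_le_of_hessian {f : (ι → κ → ℝ) → ℝ} {d : (ι → κ → ℝ) → ι → κ → ℝ}
    {H : (ι → κ → ℝ) → ι → κ → ι → κ → ℝ} (hf : HasLineGradient f d)
    (hd : ∀ i j, HasLineGradient (fun x => d x i j) (fun x => H x i j))
    (hH : ∀ i j k l, IsBoundedLipschitz fun x => H x i j k l) (hfc : Continuous f) {A : ℝ}
    (hA : ∀ x, |f x| ≤ A) {L B : ℝ} (hB0 : 0 ≤ B)
    (hL : ∀ x, ∑ i, ∑ j, ∑ k, ∑ l, |H x i j k l| ≤ L)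
    (μ ν : Measure (ι → κ → ℝ)) [IsGaussian μ] [IsGaussian ν]
    (hμ : ∀ L : StrongDual ℝ (ι → κ → ℝ), μ[L] = 0)
    (hν : ∀ L : StrongDual ℝ (ι → κ → ℝ), ν[L] = 0)
    (hB : ∀ i j k l, |∫ x, x i j * x k l ∂μ - ∫ x, x i j * x k l ∂ν| ≤ B) :
    |∫ x, f x ∂μ - ∫ x, f x ∂ν| ≤ L * B / 2 := by
  have hμ' : ∀ i j, ∫ x, x i j ∂μ = 0 := fun i j => hμ ((ContinuousLinearMap.proj j).comp
    (ContinuousLinearMap.proj (R := ℝ) (φ := fun _ : ι => κ → ℝ) i))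
  have hν' : ∀ i j, ∫ x, x i j ∂ν = 0 := fun i j => hν ((ContinuousLinearMap.proj j).comp
    (ContinuousLinearMap.proj (R := ℝ) (φ := fun _ : ι => κ → ℝ) i))
  obtain ⟨M, hM⟩ := exists_taylor_integral_bound hf hd hH hfc hA μ hμ'
  obtain ⟨M', hM'⟩ := exists_taylor_integral_bound hf hd hH hfc hA ν hν'
  have hstep : ∀ c s, 0 ≤ s → |∫ x, f (c + s • x) ∂μ - ∫ x, f (c + s • x) ∂ν|
      ≤ s ^ 2 * (L * B / 2) + (M + M') * s ^ 3 := by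
    intro c s hs
    have h1 := hM c s hs
    have h2 := hM' c s hs
    have h3 : |∑ i, ∑ j, ∑ k, ∑ l, H c i j k l * ∫ x, x k l * x i j ∂μ
        - ∑ i, ∑ j, ∑ k, ∑ l, H c i j k l * ∫ x, x k l * x i j ∂ν| ≤ L * B := by
      refine le_trans ?_ (mul_le_mul_of_nonneg_right (hL c) hB0)
      simp only [← Finset.sum_sub_distrib, ← mul_sub, Finset.sum_mul]
      refine (Finset.abs_sum_le_sum_abs _ _).trans (Finset.sum_le_sum fun i _ => ?_)
      refine (Finset.abs_sum_le_sum_abs _ _).trans (Finset.sum_le_sum fun j _ => ?_)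
      refine (Finset.abs_sum_le_sum_abs _ _).trans (Finset.sum_le_sum fun k _ => ?_)
      refine (Finset.abs_sum_le_sum_abs _ _).trans (Finset.sum_le_sum fun l _ => ?_)
      rw [abs_mul]
      exact mul_le_mul_of_nonneg_left (hB k l i j) (abs_nonneg _)
    have h4 := mul_le_mul_of_nonneg_left h3 (by positivity : 0 ≤ s ^ 2 / 2)
    rw [← abs_of_nonneg (by positivity : 0 ≤ s ^ 2 / 2), ← abs_mul,
      abs_of_nonneg (by positivity : 0 ≤ s ^ 2 / 2), mul_sub] at h4
    rw [abs_le] at h1 h2 h4 ⊢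
    constructor <;> linarith [h1.1, h1.2, h2.1, h2.2, h4.1, h4.2]
  have hlim : Filter.Tendsto (fun N : ℕ => L * B / 2 + (M + M') * √(1 / ((N : ℝ) + 1)))
      Filter.atTop (nhds (L * B / 2 + (M + M') * √0)) :=
    tendsto_const_nhds.add (tendsto_const_nhds.mul
      ((continuous_sqrt.tendsto 0).comp tendsto_one_div_add_atTop_nhds_zero_nat))
  rw [sqrt_zero, mul_zero, add_zero] at hlim
  refine ge_of_tendsto' hlim fun N => ?_
  have hN : (0 : ℝ) < (N + 1 : ℕ) := by positivity
  refine (abs_integral_sub_le_of_forall_step μ ν hμ hν hfc hA (N := N + 1) (Nat.succ_pos N)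
    fun c => hstep c (√(1 / (N + 1 : ℕ))) (sqrt_nonneg _)).trans (le_of_eq ?_)
  rw [pow_succ _ 2, sq_sqrt (by positivity)]
  push_cast
  field_simp

end GaussianComparison

section Coupling

open scoped ENNReal

variable {α β K : Type*} [MeasurableSpace α] [MeasurableSpace β] [Countable K]

lemma min_mul_inv_mul_inv_mul_add_sub_mul_inv {a b : ℝ≥0∞} (ha : a ≠ 0) (ha' : a ≠ ∞)
    (hb' : b ≠ ∞) : min a b * a⁻¹ * b⁻¹ * b + (a - b) * a⁻¹ = 1 := by
  have h : min a b * a⁻¹ * b⁻¹ * b = min a b * a⁻¹ := by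
    rcases eq_or_ne b 0 with rfl | hb
    · simp
    · rw [mul_assoc, ENNReal.inv_mul_cancel hb hb', mul_one]
  rw [h, ← add_mul, add_comm, tsub_add_min, ENNReal.mul_inv_cancel ha ha']

lemma inv_mul_smul_eq_self {R : Measure α} {D : ℝ≥0∞} (hR : R Set.univ = D) (hD : D ≠ ∞) :
    (D⁻¹ * D) • R = R := by
  rcases eq_or_ne D 0 with h | h
  · rw [Measure.measure_univ_eq_zero.1 (hR.trans h), smul_zero]
  · rw [ENNReal.inv_mul_cancel h hD, one_smul]

lemma sum_smul_add_sum_smul_eq (μ : Measure α) [IsFiniteMeasure μ] {p : K → α → ℝ≥0∞}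
    (hp : ∀ k, Measurable (p k)) (hp1 : ∀ a, ∑' k, p k a = 1) {b : K → ℝ≥0∞}
    (hb : ∀ k, b k ≠ ∞) :
    Measure.sum (fun k => (min (∫⁻ x, p k x ∂μ) (b k) * (∫⁻ x, p k x ∂μ)⁻¹ * (b k)⁻¹ * b k) •
        μ.withDensity (p k))
      + Measure.sum (fun k => ((∫⁻ x, p k x ∂μ - b k) * (∫⁻ x, p k x ∂μ)⁻¹) •
        μ.withDensity (p k)) = μ := by
  have hμ : μ = Measure.sum fun k => μ.withDensity (p k) := by
    rw [← withDensity_tsum hp]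
    conv_lhs => rw [← withDensity_one (μ := μ)]
    congr 1
    ext a
    rw [ENNReal.tsum_apply, hp1, Pi.one_apply]
  rw [Measure.sum_add_sum]
  conv_rhs => rw [hμ]
  congr 1
  ext1 k
  rcases eq_or_ne (∫⁻ x, p k x ∂μ) 0 with h | h
  · have : μ.withDensity (p k) = 0 := by
      rw [← Measure.measure_univ_eq_zero, withDensity_apply _ .univ, Measure.restrict_univ, h]
    simp [this]
  · have hle : ∫⁻ x, p k x ∂μ ≤ ∫⁻ _, 1 ∂μ :=
      lintegral_mono fun x => (ENNReal.le_tsum k).trans (hp1 x).le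
    have hfin : ∫⁻ x, p k x ∂μ ≠ ∞ := ne_top_of_le_ne_top (by simp) hle
    rw [← add_smul, min_mul_inv_mul_inv_mul_add_sub_mul_inv h hfin (hb k), one_smul]

/-- Coupling of two probability measures that hits a common window of two partitions of unity
except on an event controlled by the discrepancy of the window masses. -/
lemma exists_coupling_of_partition (μ : Measure α) (ν : Measure β) [IsProbabilityMeasure μ]
    [IsProbabilityMeasure ν] {p : K → α → ℝ≥0∞} {q : K → β → ℝ≥0∞}
    (hp : ∀ k, Measurable (p k)) (hq : ∀ k, Measurable (q k)) (hp1 : ∀ a, ∑' k, p k a = 1)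
    (hq1 : ∀ b, ∑' k, q k b = 1) :
    ∃ γ : Measure (α × β), γ.map Prod.fst = μ ∧ γ.map Prod.snd = ν ∧
      γ {z | ∀ k, p k z.1 = 0 ∨ q k z.2 = 0}
        ≤ ∑' k, (∫⁻ x, p k x ∂μ - ∫⁻ y, q k y ∂ν) := by
  set a : K → ℝ≥0∞ := fun k => ∫⁻ x, p k x ∂μ with ha
  set b : K → ℝ≥0∞ := fun k => ∫⁻ y, q k y ∂ν with hb
  have ha1 : ∑' k, a k = 1 := by
    rw [ha, ← lintegral_tsum fun k => (hp k).aemeasurable]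
    simp [hp1]
  have hb1 : ∑' k, b k = 1 := by
    rw [hb, ← lintegral_tsum fun k => (hq k).aemeasurable]
    simp [hq1]
  have ha' : ∀ k, a k ≠ ∞ := fun k =>
    ne_top_of_le_ne_top ENNReal.one_ne_top ((ENNReal.le_tsum k).trans ha1.le)
  have hb' : ∀ k, b k ≠ ∞ := fun k =>
    ne_top_of_le_ne_top ENNReal.one_ne_top ((ENNReal.le_tsum k).trans hb1.le)
  have hμk : ∀ k, μ.withDensity (p k) Set.univ = a k := fun k => by
    rw [withDensity_apply _ .univ, Measure.restrict_univ]
  have hνk : ∀ k, ν.withDensity (q k) Set.univ = b k := fun k => by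
    rw [withDensity_apply _ .univ, Measure.restrict_univ]
  set D := ∑' k, (a k - b k) with hD
  have hD' : ∑' k, (b k - a k) = D := by
    have h1 : D + ∑' k, min (a k) (b k) = 1 := by
      rw [hD, ← ENNReal.tsum_add, ← ha1]
      exact tsum_congr fun k => tsub_add_min
    have h2 : ∑' k, (b k - a k) + ∑' k, min (a k) (b k) = 1 := by
      rw [← ENNReal.tsum_add, ← hb1]
      exact tsum_congr fun k => by rw [min_comm, tsub_add_min]
    refine (ENNReal.add_left_inj ?_).1 (h2.trans h1.symm)
    exact ne_top_of_le_ne_top ENNReal.one_ne_top (le_add_self.trans h1.le)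
  have hDtop : D ≠ ∞ := ne_top_of_le_ne_top ENNReal.one_ne_top
    ((ENNReal.tsum_le_tsum fun k => tsub_le_self).trans ha1.le)
  set R₁ := Measure.sum fun k => ((a k - b k) * (a k)⁻¹) • μ.withDensity (p k) with hR₁
  set R₂ := Measure.sum fun k => ((b k - a k) * (b k)⁻¹) • ν.withDensity (q k) with hR₂
  have hcancel : ∀ u v : ℝ≥0∞, u ≠ ∞ → (u - v) * u⁻¹ * u = u - v := by
    intro u v hu
    rcases eq_or_ne u 0 with rfl | hu0
    · simp
    · rw [mul_assoc, ENNReal.inv_mul_cancel hu0 hu, mul_one]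
  have hm₁ : R₁ Set.univ = D := by
    rw [hR₁, Measure.sum_apply _ .univ]
    exact tsum_congr fun k => by
      rw [Measure.smul_apply, hμk, smul_eq_mul, hcancel _ _ (ha' k)]
  have hm₂ : R₂ Set.univ = D := by
    rw [hR₂, Measure.sum_apply _ .univ, ← hD']
    exact tsum_congr fun k => by
      rw [Measure.smul_apply, hνk, smul_eq_mul, hcancel _ _ (hb' k)]
  refine ⟨Measure.sum (fun k => (min (a k) (b k) * (a k)⁻¹ * (b k)⁻¹) •
    (μ.withDensity (p k)).prod (ν.withDensity (q k))) + D⁻¹ • R₁.prod R₂, ?_, ?_, ?_⟩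
  · rw [Measure.map_add _ _ measurable_fst, Measure.map_sum measurable_fst.aemeasurable,
      Measure.map_smul, Measure.map_fst_prod, hm₂, smul_smul, inv_mul_smul_eq_self hm₁ hDtop]
    conv_rhs => rw [← sum_smul_add_sum_smul_eq μ hp hp1 hb']
    congr 2
    ext1 k
    rw [Measure.map_smul, Measure.map_fst_prod, hνk, smul_smul]
  · rw [Measure.map_add _ _ measurable_snd, Measure.map_sum measurable_snd.aemeasurable,
      Measure.map_smul, Measure.map_snd_prod, hm₁, smul_smul, inv_mul_smul_eq_self hm₂ hDtop]
    conv_rhs => rw [← sum_smul_add_sum_smul_eq ν hq hq1 ha']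
    congr 2
    ext1 k
    rw [Measure.map_smul, Measure.map_snd_prod, hμk, smul_smul, min_comm,
      mul_right_comm (min (b k) (a k))]
  · have h1 : Measure.sum (fun k => (min (a k) (b k) * (a k)⁻¹ * (b k)⁻¹) •
        (μ.withDensity (p k)).prod (ν.withDensity (q k)))
        {z | ∀ k, p k z.1 = 0 ∨ q k z.2 = 0} = 0 := by
      rw [Measure.sum_apply_eq_zero]
      intro k
      rw [Measure.smul_apply, smul_eq_mul]
      refine mul_eq_zero_of_right _ (measure_mono_null
        (t := ({x | p k x = 0} ×ˢ Set.univ) ∪ (Set.univ ×ˢ {y | q k y = 0})) ?_ ?_)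
      · intro z hz
        simpa using hz k
      · refine measure_union_null ?_ ?_
        · rw [Measure.prod_prod, (withDensity_apply_eq_zero (hp k)).2 ?_, zero_mul]
          exact measure_mono_null (t := ∅) (fun x hx => hx.1 hx.2) (by simp)
        · rw [Measure.prod_prod, (withDensity_apply_eq_zero (hq k)).2 ?_, mul_zero]
          exact measure_mono_null (t := ∅) (fun x hx => hx.1 hx.2) (by simp)
    rw [Measure.add_apply, h1, zero_add, Measure.smul_apply, smul_eq_mul]
    calc D⁻¹ * (R₁.prod R₂) {z | ∀ k, p k z.1 = 0 ∨ q k z.2 = 0}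
        ≤ D⁻¹ * (R₁.prod R₂) (Set.univ ×ˢ Set.univ) := by
          gcongr
          simp
      _ = D⁻¹ * D * D := by rw [Measure.prod_prod, hm₁, hm₂, mul_assoc]
      _ ≤ 1 * D := by
          gcongr
          exact ENNReal.inv_mul_le_one D
      _ = D := one_mul D

end Coupling

section MinMaxCoupling

open scoped ENNReal

lemma exists_window_comparison : ∃ C : ℝ, 0 < C ∧ ∀ (ι κ : Type) [Fintype ι] [Fintype κ]
    [Nonempty ι] [Nonempty κ] (β δ τ : ℝ), 0 < β → 0 < δ → 1 / (β * (1 + δ)) < τ →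
    ∀ (μ ν : Measure (ι → κ → ℝ)), IsGaussian μ → IsGaussian ν →
    (∀ L : StrongDual ℝ (ι → κ → ℝ), μ[L] = 0) → (∀ L : StrongDual ℝ (ι → κ → ℝ), ν[L] = 0) →
    ∀ B : ℝ, 0 ≤ B → (∀ i j k l, |∫ x, x i j * x k l ∂μ - ∫ x, x i j * x k l ∂ν| ≤ B) →
    ∀ S : Finset ℤ, |∫ x, ∑ k ∈ S, stepBump (softMinMax β δ x / τ - k) ∂μ
      - ∫ x, ∑ k ∈ S, stepBump (softMinMax β δ x / τ - k) ∂ν| ≤ C * β * (1 + δ) * τ⁻¹ * B := by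
  classical
  obtain ⟨c, hc, hG⟩ := exists_smooth_window_sum
  refine ⟨2 * c, by positivity, fun ι κ _ _ _ _ β δ τ hβ hδ hτ μ ν _ _ hμ hν B hB0 hB S => ?_⟩
  have hs : 0 < β * (1 + δ) := by positivity
  have hτ0 : 0 < τ := (by positivity : 0 < 1 / (β * (1 + δ))).trans hτ
  obtain ⟨G₁, G₂, K, hd1, hd2, hb1, hb2, hK⟩ := hG τ hτ0 S
  have hbound : ∀ x : ι → κ → ℝ, |∑ k ∈ S, stepBump (softMinMax β δ x / τ - k)| ≤ S.card := by
    intro x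
    refine (Finset.abs_sum_le_sum_abs _ _).trans ?_
    refine (Finset.sum_le_card_nsmul S _ 1 fun k _ => ?_).trans (by simp)
    rw [abs_of_nonneg (stepBump_nonneg _)]
    exact stepBump_le_one _
  have hcont : Continuous fun x : ι → κ → ℝ => ∑ k ∈ S, stepBump (softMinMax β δ x / τ - k) :=
    continuous_finsetSum _ fun k _ => continuous_stepBump.comp
      (((continuous_softMinMax hβ hδ).div_const τ).sub continuous_const)
  refine (abs_integral_sub_le_of_hessian
    (hasLineGradient_comp (ι := ι) (κ := κ) hd1 hβ hδ)
    (fun i j => hasLineGradient_comp_gradient hd2 hβ hδ i j)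
    (fun i j k l => isBoundedLipschitz_compHessian hd2 hb1 hb2 hK hβ hδ i j k l) hcont hbound hB0
    (sum_abs_compHessian_le hb1 hb2 hβ hδ) μ ν hμ hν hB).trans ?_
  have h1 : c / τ ^ 2 ≤ c / τ * (β * (1 + δ)) := by
    rw [div_lt_iff₀ hs] at hτ
    rw [pow_two, ← div_div, div_le_iff₀ hτ0, mul_assoc]
    exact le_mul_of_one_le_right (by positivity) (by linarith)
  have h2 : c / τ ^ 2 + c / τ * (2 * β * (1 + δ)) ≤ 4 * (c / τ * (β * (1 + δ))) := by
    have : 0 ≤ c / τ * (β * (1 + δ)) := by positivity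
    linarith
  calc (c / τ ^ 2 + c / τ * (2 * β * (1 + δ))) * B / 2
      ≤ 4 * (c / τ * (β * (1 + δ))) * B / 2 := by gcongr
    _ = 2 * c * β * (1 + δ) * τ⁻¹ * B := by rw [div_eq_mul_inv c]; ring

lemma tsum_ofReal_tsub_ofReal_le {K : Type*} {u v : K → ℝ} (hv : ∀ k, 0 ≤ v k) {η : ℝ}
    (h : ∀ S : Finset K, ∑ k ∈ S, u k - ∑ k ∈ S, v k ≤ η) :
    ∑' k, (ENNReal.ofReal (u k) - ENNReal.ofReal (v k)) ≤ ENNReal.ofReal η := by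
  classical
  rw [ENNReal.tsum_eq_iSup_sum]
  refine iSup_le fun S => ?_
  simp only [← ENNReal.ofReal_sub _ (hv _)]
  rw [← Finset.sum_filter_add_sum_filter_not S (fun k => 0 ≤ u k - v k),
    Finset.sum_eq_zero (s := S.filter fun k => ¬ 0 ≤ u k - v k) fun k hk =>
      ENNReal.ofReal_of_nonpos (not_le.1 (Finset.mem_filter.1 hk).2).le,
    add_zero, ← ENNReal.ofReal_sum_of_nonneg fun k hk => (Finset.mem_filter.1 hk).2,
    Finset.sum_sub_distrib]
  exact ENNReal.ofReal_le_ofReal (h _)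

lemma strongDual_matrix_apply {n m : ℕ} (L : StrongDual ℝ (Fin n → Fin m → ℝ))
    (x : Fin n → Fin m → ℝ) :
    L x = ∑ i, ∑ j, L (Pi.single i (Pi.single j 1)) * x i j := by
  have hx : x = ∑ i, ∑ j, x i j • Pi.single i (Pi.single j (1 : ℝ)) := by
    ext a b
    simp [Finset.sum_apply, Pi.single_apply, ite_apply, Finset.sum_ite_eq]
  conv_lhs => rw [hx]
  simp only [map_sum, map_smul, smul_eq_mul, mul_comm]

lemma IsCenteredGaussianMatrix.map_dual_eq {Ω : Type*} [MeasurableSpace Ω] {P : Measure Ω}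
    {n m : ℕ} {X : Ω → Fin n → Fin m → ℝ} (h : IsCenteredGaussianMatrix P X) (hX : Measurable X)
    (L : StrongDual ℝ (Fin n → Fin m → ℝ)) :
    ∃ v : NNReal, (P.map X).map L = gaussianReal 0 v := by
  obtain ⟨v, hv⟩ := h fun i j => L (Pi.single i (Pi.single j 1))
  refine ⟨v, ?_⟩
  rw [Measure.map_map (by fun_prop) hX, ← hv]
  congr 1 with ω
  exact strongDual_matrix_apply L (X ω)

lemma IsCenteredGaussianMatrix.isGaussian_map {Ω : Type*} [MeasurableSpace Ω] {P : Measure Ω}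
    {n m : ℕ} {X : Ω → Fin n → Fin m → ℝ} (h : IsCenteredGaussianMatrix P X)
    (hX : Measurable X) : IsGaussian (P.map X) :=
  isGaussian_of_map_eq_gaussianReal fun L => ⟨0, h.map_dual_eq hX L⟩

lemma IsCenteredGaussianMatrix.integral_dual_eq_zero {Ω : Type*} [MeasurableSpace Ω]
    {P : Measure Ω} {n m : ℕ} {X : Ω → Fin n → Fin m → ℝ} (h : IsCenteredGaussianMatrix P X)
    (hX : Measurable X) (L : StrongDual ℝ (Fin n → Fin m → ℝ)) : (P.map X)[L] = 0 := by
  obtain ⟨v, hv⟩ := h.map_dual_eq hX L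
  have h1 : ∫ y, y ∂((P.map X).map L) = ∫ x, L x ∂(P.map X) :=
    integral_map (by fun_prop) (by fun_prop)
  rw [← h1, hv, integral_id_gaussianReal]

lemma abs_softMinMax_sub_lt_of_window {ι κ : Type*} {β δ τ : ℝ} (hτ : 0 < τ)
    {x y : ι → κ → ℝ} [Fintype ι] [Fintype κ] {k : ℤ}
    (hx : ENNReal.ofReal (stepBump (softMinMax β δ x / τ - k)) ≠ 0)
    (hy : ENNReal.ofReal (stepBump (softMinMax β δ y / τ - k)) ≠ 0) :
    |softMinMax β δ x - softMinMax β δ y| < 2 * τ := by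
  have key : ∀ t : ℝ, ENNReal.ofReal (stepBump (t / τ - k)) ≠ 0 → k * τ < t ∧ t < (k + 2) * τ := by
    intro t ht
    rw [← lt_div_iff₀ hτ, ← div_lt_iff₀ hτ]
    constructor <;> by_contra! hcon <;> apply ht
    · rw [stepBump_of_nonpos (by linarith), ENNReal.ofReal_zero]
    · rw [stepBump_of_two_le (by linarith), ENNReal.ofReal_zero]
  have h1 := key _ hx
  have h2 := key _ hy
  rw [abs_lt]
  constructor <;> linarith [h1.1, h1.2, h2.1, h2.2]

/-- Two measures whose softened min-max window masses are close admit a coupling under which the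
min-max functionals are close with high probability. -/
lemma exists_minMax_coupling {ι κ : Type*} [Fintype ι] [Fintype κ] [Nonempty ι] [Nonempty κ]
    {β δ τ η : ℝ} (hβ : 0 < β) (hδ : 0 < δ) (hτ : 0 < τ) (μ ν : Measure (ι → κ → ℝ))
    [IsProbabilityMeasure μ] [IsProbabilityMeasure ν]
    (h : ∀ S : Finset ℤ, |∫ x, ∑ k ∈ S, stepBump (softMinMax β δ x / τ - k) ∂μ
      - ∫ x, ∑ k ∈ S, stepBump (softMinMax β δ x / τ - k) ∂ν| ≤ η) :
    ∃ γ : Measure ((ι → κ → ℝ) × (ι → κ → ℝ)), γ.map Prod.fst = μ ∧ γ.map Prod.snd = ν ∧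
      γ {z | 2 * max (log (Fintype.card ι) / (β * δ)) (log (Fintype.card κ) / β) + 3 * τ
        < |(⨅ i, ⨆ j, z.1 i j) - ⨅ i, ⨆ j, z.2 i j|} ≤ ENNReal.ofReal η := by
  have hcont : ∀ k : ℤ, Continuous fun x : ι → κ → ℝ => stepBump (softMinMax β δ x / τ - k) :=
    fun k => continuous_stepBump.comp
      (((continuous_softMinMax hβ hδ).div_const τ).sub continuous_const)
  have h_int : ∀ (ρ : Measure (ι → κ → ℝ)) [IsProbabilityMeasure ρ] (k : ℤ),
      Integrable (fun x => stepBump (softMinMax β δ x / τ - k)) ρ := fun ρ _ k =>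
    Integrable.of_bound (hcont k).aestronglyMeasurable 1 (Filter.Eventually.of_forall fun x => by
      rw [norm_of_nonneg (stepBump_nonneg _)]
      exact stepBump_le_one _)
  have hmeas : ∀ k : ℤ, Measurable fun x : ι → κ → ℝ =>
      ENNReal.ofReal (stepBump (softMinMax β δ x / τ - k)) :=
    fun k => (hcont k).measurable.ennreal_ofReal
  obtain ⟨γ, h1, h2, h3⟩ := exists_coupling_of_partition μ ν hmeas hmeas
    (fun x => tsum_ofReal_stepBump (softMinMax β δ x / τ))
    (fun x => tsum_ofReal_stepBump (softMinMax β δ x / τ))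
  refine ⟨γ, h1, h2, (measure_mono ?_).trans (h3.trans ?_)⟩
  · intro z hz k
    by_contra! hcon
    have hw := abs_softMinMax_sub_lt_of_window hτ hcon.1 hcon.2
    have e1 := abs_softMinMax_sub_le hβ hδ z.1
    have e2 := abs_softMinMax_sub_le hβ hδ z.2
    rw [Set.mem_ofPred_eq] at hz
    refine hz.not_ge ?_
    rw [abs_lt] at hw
    rw [abs_le] at e1 e2 ⊢
    constructor <;> linarith [hw.1, hw.2, e1.1, e1.2, e2.1, e2.2]
  · simp only [← ofReal_integral_eq_lintegral_ofReal (h_int _ _)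
      (Filter.Eventually.of_forall fun x => stepBump_nonneg _)]
    refine tsum_ofReal_tsub_ofReal_le (fun k => integral_nonneg fun x => stepBump_nonneg _)
      fun S => ?_
    rw [← integral_finsetSum _ fun k _ => h_int μ k, ← integral_finsetSum _ fun k _ => h_int ν k]
    exact (le_abs_self _).trans (h S)

lemma measurable_iInf_iSup_apply {ι κ : Type*} [Finite ι] [Finite κ] :
    Measurable fun x : ι → κ → ℝ => ⨅ i, ⨆ j, x i j :=
  Measurable.iInf fun i => Measurable.iSup fun j =>
    (measurable_pi_apply j).comp (measurable_pi_apply i)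

lemma le_ciSup_four {ι κ : Type*} [Finite ι] [Finite κ] (f : ι → κ → ι → κ → ℝ) (i : ι) (j : κ)
    (k : ι) (l : κ) : f i j k l ≤ ⨆ i, ⨆ j, ⨆ k, ⨆ l, f i j k l :=
  ((le_ciSup (Set.finite_range _).bddAbove l).trans
    (le_ciSup (f := fun k => ⨆ l, f i j k l) (Set.finite_range _).bddAbove k)).trans
    ((le_ciSup (f := fun j => ⨆ k, ⨆ l, f i j k l) (Set.finite_range _).bddAbove j).trans
      (le_ciSup (f := fun i => ⨆ j, ⨆ k, ⨆ l, f i j k l) (Set.finite_range _).bddAbove i))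

lemma le_add_div_one_sub {ε y : ℝ} (hε : 0 ≤ ε) (hε' : ε < 1) (hy : 0 ≤ y) :
    y ≤ (ε + y) / (1 - ε) := by
  rw [le_div_iff₀ (by linarith)]
  nlinarith [mul_nonneg hε hy]

lemma sqrt_exp_neg_mul_one_add_lt_one {α : ℝ} (hα : 0 < α) : √(exp (-α) * (1 + α)) < 1 := by
  rw [sqrt_lt' one_pos, one_pow, exp_neg, inv_mul_lt_iff₀ (exp_pos α), mul_one, add_comm]
  exact add_one_lt_exp hα.ne'

end MinMaxCoupling

theorem stmt_1 :
    ∃ C : ℝ, 0 < C ∧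
      ∀ (n m : ℕ), 1 ≤ n → 1 ≤ m →
      ∀ (Ω : Type) [MeasurableSpace Ω] (P : Measure Ω), IsProbabilityMeasure P →
      ∀ (X X' : Ω → Fin n → Fin m → ℝ), Measurable X → Measurable X' →
      IsCenteredGaussianMatrix P X → IsCenteredGaussianMatrix P X' →
      ∀ (β δ τ : ℝ), 0 < β → 0 < δ → 1 / (β * (1 + δ)) < τ →
      ∃ (Ω' : Type) (_ : MeasurableSpace Ω') (P' : Measure Ω') (V W : Ω' → ℝ),
        IsProbabilityMeasure P' ∧ Measurable V ∧ Measurable W ∧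
        Measure.map V P' = Measure.map (fun ω => ⨅ i, ⨆ j, X ω i j) P ∧
        Measure.map W P' = Measure.map (fun ω => ⨅ i, ⨆ j, X' ω i j) P ∧
        P' {ω' | 2 * max (Real.log n / (β * δ)) (Real.log m / β) + 3 * τ < |V ω' - W ω'|}
          ≤ ENNReal.ofReal
            ((Real.sqrt (Real.exp (-(β ^ 2 * (1 + δ) ^ 2 * τ ^ 2 - 1)) *
                  (1 + (β ^ 2 * (1 + δ) ^ 2 * τ ^ 2 - 1)))
              + C * β * (1 + δ) * τ⁻¹ *
                  (⨆ i₁, ⨆ j₁, ⨆ i₂, ⨆ j₂,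
                    |∫ ω, (X ω i₁ j₁ * X ω i₂ j₂ - X' ω i₁ j₁ * X' ω i₂ j₂) ∂P|)) /
              (1 - Real.sqrt (Real.exp (-(β ^ 2 * (1 + δ) ^ 2 * τ ^ 2 - 1)) *
                  (1 + (β ^ 2 * (1 + δ) ^ 2 * τ ^ 2 - 1))))) := by
  obtain ⟨C, hC, hwin⟩ := exists_window_comparison
  refine ⟨C, hC, fun n m hn hm Ω _ P _ X X' hX hX' hg hg' β δ τ hβ hδ hτ => ?_⟩
  have : Nonempty (Fin n) := ⟨⟨0, hn⟩⟩
  have : Nonempty (Fin m) := ⟨⟨0, hm⟩⟩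
  have hs : 0 < β * (1 + δ) := by positivity
  have hτ0 : 0 < τ := (by positivity : 0 < 1 / (β * (1 + δ))).trans hτ
  have hG := hg.isGaussian_map hX
  have hG' := hg'.isGaussian_map hX'
  set B : ℝ := ⨆ i₁, ⨆ j₁, ⨆ i₂, ⨆ j₂,
    |∫ ω, (X ω i₁ j₁ * X ω i₂ j₂ - X' ω i₁ j₁ * X' ω i₂ j₂) ∂P| with hBdef
  have hle : ∀ i j k l, |∫ ω, (X ω i j * X ω k l - X' ω i j * X' ω k l) ∂P| ≤ B :=
    le_ciSup_four fun i j k l => |∫ ω, (X ω i j * X ω k l - X' ω i j * X' ω k l) ∂P|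
  have hB0 : 0 ≤ B := (abs_nonneg _).trans (hle ⟨0, hn⟩ ⟨0, hm⟩ ⟨0, hn⟩ ⟨0, hm⟩)
  have hmeas : ∀ (i : Fin n) (j : Fin m) (k : Fin n) (l : Fin m),
      Measurable fun x : Fin n → Fin m → ℝ => x i j * x k l := by fun_prop
  have hB : ∀ i j k l, |∫ x, x i j * x k l ∂(P.map X) - ∫ x, x i j * x k l ∂(P.map X')| ≤ B := by
    intro i j k l
    have i1 : Integrable (fun ω => X ω i j * X ω k l) P :=
      (integrable_apply_mul_apply (P.map X) i j k l).comp_measurable hX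
    have i2 : Integrable (fun ω => X' ω i j * X' ω k l) P :=
      (integrable_apply_mul_apply (P.map X') i j k l).comp_measurable hX'
    rw [integral_map hX.aemeasurable (hmeas i j k l).aestronglyMeasurable,
      integral_map hX'.aemeasurable (hmeas i j k l).aestronglyMeasurable, ← integral_sub i1 i2]
    exact hle i j k l
  obtain ⟨γ, h1, h2, h3⟩ := exists_minMax_coupling hβ hδ hτ0 (P.map X) (P.map X')
    (hwin (Fin n) (Fin m) β δ τ hβ hδ hτ (P.map X) (P.map X') hG hG'
      (hg.integral_dual_eq_zero hX) (hg'.integral_dual_eq_zero hX') B hB0 hB)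
  simp only [Fintype.card_fin] at h3
  refine ⟨_, inferInstance, γ, fun z => ⨅ i, ⨆ j, z.1 i j, fun z => ⨅ i, ⨆ j, z.2 i j, ⟨?_⟩,
    measurable_iInf_iSup_apply.comp measurable_fst,
    measurable_iInf_iSup_apply.comp measurable_snd, ?_, ?_, h3.trans ?_⟩
  · rw [← Set.preimage_univ (f := Prod.fst), ← Measure.map_apply measurable_fst .univ, h1,
      measure_univ]
  · change γ.map ((fun x : Fin n → Fin m → ℝ => ⨅ i, ⨆ j, x i j) ∘ Prod.fst) = _
    rw [← Measure.map_map measurable_iInf_iSup_apply measurable_fst, h1,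
      Measure.map_map measurable_iInf_iSup_apply hX]
    rfl
  · change γ.map ((fun x : Fin n → Fin m → ℝ => ⨅ i, ⨆ j, x i j) ∘ Prod.snd) = _
    rw [← Measure.map_map measurable_iInf_iSup_apply measurable_snd, h2,
      Measure.map_map measurable_iInf_iSup_apply hX']
    rfl
  · refine ENNReal.ofReal_le_ofReal (le_add_div_one_sub (sqrt_nonneg _)
      (sqrt_exp_neg_mul_one_add_lt_one ?_) (by positivity))
    have h4 : 1 < τ * (β * (1 + δ)) := (div_lt_iff₀ hs).1 hτ
    have h5 : 1 < (τ * (β * (1 + δ))) ^ 2 := one_lt_pow₀ h4 two_ne_zero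
    linarith [show (τ * (β * (1 + δ))) ^ 2 = β ^ 2 * (1 + δ) ^ 2 * τ ^ 2 by ring]
end

section
/- Let X and X' be n×m random matrices with mean-zero entries having finite absolute third moments, let β > 0, δ > 0, τ > 1/(β(1+δ)), and let g : ℝ → ℝ be a smooth function with ‖g'‖_∞ ≤ τ⁻¹, ‖g''‖_∞ ≤ C₀ β(1+δ) τ⁻¹ and ‖g'''‖_∞ ≤ C₀ β²(1+δ)² τ⁻¹ for some constant C₀. Then, writing f = g ∘ F^{βδ}, one has |E[f(X)] − E[f(X')]| ≤ (C β(1+δ)/τ) (B₁ + B₁' + B₃ + β(1+δ)(B₂ + B₂')), where C > 0 is a constant depending only on C₀. -/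
open MeasureTheory ProbabilityTheory Real

/-- The smooth min-max approximation `F^{βδ}`. -/
noncomputable def Fbd (β δ : ℝ) {n m : ℕ} (x : Fin n → Fin m → ℝ) : ℝ :=
  -(1 / (β * δ)) * Real.log (∑ i, (∑ j, Real.exp (β * x i j)) ^ (-δ))

/-! ### Uniform averages over finite index sets -/

/-- The uniform average of a finite family of reals. -/
noncomputable def finAvg {n : ℕ} (u : Fin n → ℝ) : ℝ := (n : ℝ)⁻¹ * ∑ i, u i

lemma abs_sum_mul_le_s3 {ι : Type*} [Fintype ι] {w u : ι → ℝ} {B : ℝ} (hw : ∀ i, 0 ≤ w i)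
    (hw1 : ∑ i, w i = 1) (hu : ∀ i, |u i| ≤ B) : |∑ i, w i * u i| ≤ B := by
  calc |∑ i, w i * u i| ≤ ∑ i, |w i * u i| := Finset.abs_sum_le_sum_abs _ _
    _ ≤ ∑ i, w i * B := Finset.sum_le_sum fun i _ => by
        rw [abs_mul, abs_of_nonneg (hw i)]
        exact mul_le_mul_of_nonneg_left (hu i) (hw i)
    _ = B := by rw [← Finset.sum_mul, hw1, one_mul]

lemma abs_finAvg_le {n : ℕ} (hn : 1 ≤ n) {u : Fin n → ℝ} {B : ℝ} (hu : ∀ i, |u i| ≤ B) :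
    |finAvg u| ≤ B := by
  have hn' : (n : ℝ) ≠ 0 := by positivity
  unfold finAvg
  rw [Finset.mul_sum]
  exact abs_sum_mul_le_s3 (fun _ => by positivity) (by simp [hn']) hu

lemma finAvg_sub {n : ℕ} (u v : Fin n → ℝ) :
    finAvg u - finAvg v = finAvg fun i => u i - v i := by
  simp only [finAvg, Finset.sum_sub_distrib, mul_sub]

lemma finAvg_mul_finAvg {n k : ℕ} (u : Fin n → ℝ) (v : Fin k → ℝ) :
    finAvg u * finAvg v = finAvg fun i => finAvg fun j => u i * v j := by
  simp only [finAvg, ← Finset.mul_sum, ← Finset.sum_mul]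
  ring

lemma integrable_finAvg {n : ℕ} {Ω : Type*} [MeasurableSpace Ω] {P : Measure Ω}
    {u : Ω → Fin n → ℝ} (hu : ∀ i, Integrable (fun ω => u ω i) P) :
    Integrable (fun ω => finAvg (u ω)) P :=
  (integrable_finsetSum _ fun i _ => hu i).const_mul _

lemma integral_finAvg {n : ℕ} {Ω : Type*} [MeasurableSpace Ω] {P : Measure Ω}
    {u : Ω → Fin n → ℝ} (hu : ∀ i, Integrable (fun ω => u ω i) P) :
    ∫ ω, finAvg (u ω) ∂P = finAvg fun i => ∫ ω, u ω i ∂P := by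
  unfold finAvg
  rw [integral_const_mul, integral_finsetSum _ fun i _ => hu i]

/-! ### Exponential tilting along a ray -/

section Ray

variable {n m : ℕ} (β δ : ℝ) (x : Fin n → Fin m → ℝ)

/-- The partition function of row `i` at the point `t • x`. -/
noncomputable def rowSum (i : Fin n) (t : ℝ) : ℝ := ∑ j, Real.exp (β * (t * x i j))

/-- The `k`-th moment of row `i` of `x` under the softmax weights at `t • x`. -/
noncomputable def rowMoment (k : ℕ) (i : Fin n) (t : ℝ) : ℝ :=
  (∑ j, Real.exp (β * (t * x i j)) * x i j ^ k) / rowSum β x i t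

/-- The partition function over the rows at `t • x`. -/
noncomputable def totalSum (t : ℝ) : ℝ := ∑ i, rowSum β x i t ^ (-δ)

/-- The weight of row `i` at `t • x`. -/
noncomputable def rowWeight (i : Fin n) (t : ℝ) : ℝ :=
  rowSum β x i t ^ (-δ) / totalSum β δ x t

/-- The derivative of `t ↦ Fbd β δ (t • x)`. -/
noncomputable def rayDeriv (t : ℝ) : ℝ := ∑ i, rowWeight β δ x i t * rowMoment β x 1 i t

/-- The second derivative of `t ↦ Fbd β δ (t • x)`. -/
noncomputable def rayDeriv2 (t : ℝ) : ℝ :=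
  ∑ i, rowWeight β δ x i t *
      (β * (rowMoment β x 2 i t - (1 + δ) * rowMoment β x 1 i t ^ 2))
    + δ * β * rayDeriv β δ x t ^ 2

/-- The third derivative of `t ↦ Fbd β δ (t • x)`. -/
noncomputable def rayDeriv3 (t : ℝ) : ℝ :=
  ∑ i, rowWeight β δ x i t *
      (β * (β * (rowMoment β x 3 i t - rowMoment β x 2 i t * rowMoment β x 1 i t)
          - (1 + δ) * (2 * rowMoment β x 1 i t *
            (β * (rowMoment β x 2 i t - rowMoment β x 1 i t ^ 2))))
        - δ * β * (rowMoment β x 1 i t *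
          (β * (rowMoment β x 2 i t - (1 + δ) * rowMoment β x 1 i t ^ 2))))
    + δ * β * rayDeriv β δ x t *
      (∑ i, rowWeight β δ x i t *
        (β * (rowMoment β x 2 i t - (1 + δ) * rowMoment β x 1 i t ^ 2)))
    + δ * β * (2 * rayDeriv β δ x t * rayDeriv2 β δ x t)

lemma rowSum_pos (hm : 1 ≤ m) (i : Fin n) (t : ℝ) : 0 < rowSum β x i t := by
  have : Nonempty (Fin m) := ⟨⟨0, hm⟩⟩
  exact Finset.sum_pos (fun j _ => Real.exp_pos _) Finset.univ_nonempty

lemma totalSum_pos (hn : 1 ≤ n) (hm : 1 ≤ m) (t : ℝ) : 0 < totalSum β δ x t := by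
  have : Nonempty (Fin n) := ⟨⟨0, hn⟩⟩
  exact Finset.sum_pos (fun i _ => Real.rpow_pos_of_pos (rowSum_pos β x hm i t) _)
    Finset.univ_nonempty

lemma rowWeight_nonneg (hn : 1 ≤ n) (hm : 1 ≤ m) (i : Fin n) (t : ℝ) :
    0 ≤ rowWeight β δ x i t :=
  div_nonneg (Real.rpow_nonneg (rowSum_pos β x hm i t).le _) (totalSum_pos β δ x hn hm t).le

lemma sum_rowWeight (hn : 1 ≤ n) (hm : 1 ≤ m) (t : ℝ) : ∑ i, rowWeight β δ x i t = 1 := by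
  simp only [rowWeight, ← Finset.sum_div]
  exact div_self (totalSum_pos β δ x hn hm t).ne'

lemma abs_rowMoment_le (hm : 1 ≤ m) {K : ℝ} (hK : ∀ i j, |x i j| ≤ K) (k : ℕ) (i : Fin n)
    (t : ℝ) : |rowMoment β x k i t| ≤ K ^ k := by
  have h := rowSum_pos β x hm i t
  have : rowMoment β x k i t
      = ∑ j, Real.exp (β * (t * x i j)) / rowSum β x i t * x i j ^ k := by
    rw [rowMoment, Finset.sum_div]
    exact Finset.sum_congr rfl fun j _ => by ring
  rw [this]
  refine abs_sum_mul_le_s3 (fun j => by positivity) ?_ fun j => ?_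
  · rw [← Finset.sum_div]
    exact div_self h.ne'
  · rw [abs_pow]
    exact pow_le_pow_left₀ (abs_nonneg _) (hK i j) k

lemma hasDerivAt_expSum (k : ℕ) (i : Fin n) (t : ℝ) :
    HasDerivAt (fun t => ∑ j, Real.exp (β * (t * x i j)) * x i j ^ k)
      (β * ∑ j, Real.exp (β * (t * x i j)) * x i j ^ (k + 1)) t := by
  rw [Finset.mul_sum]
  refine HasDerivAt.fun_sum fun j _ => ?_
  have h := ((((hasDerivAt_id t).mul_const (x i j)).const_mul β).exp).mul_const (x i j ^ k)
  refine h.congr_deriv ?_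
  simp only [id]
  ring

lemma hasDerivAt_rowSum (hm : 1 ≤ m) (i : Fin n) (t : ℝ) :
    HasDerivAt (rowSum β x i) (β * (rowSum β x i t * rowMoment β x 1 i t)) t := by
  have h := hasDerivAt_expSum β x 0 i t
  simp only [pow_zero, mul_one, zero_add] at h
  refine h.congr_deriv ?_
  rw [rowMoment, mul_div_cancel₀ _ (rowSum_pos β x hm i t).ne']

lemma hasDerivAt_rowMoment (hm : 1 ≤ m) (k : ℕ) (i : Fin n) (t : ℝ) :
    HasDerivAt (rowMoment β x k i)
      (β * (rowMoment β x (k + 1) i t - rowMoment β x k i t * rowMoment β x 1 i t)) t := by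
  have h0 := (rowSum_pos β x hm i t).ne'
  refine ((hasDerivAt_expSum β x k i t).div (hasDerivAt_rowSum β x hm i t) h0).congr_deriv ?_
  simp only [rowMoment]
  field_simp

lemma hasDerivAt_rowSum_rpow (hm : 1 ≤ m) (i : Fin n) (t : ℝ) :
    HasDerivAt (fun t => rowSum β x i t ^ (-δ))
      (-(δ * β) * (rowSum β x i t ^ (-δ) * rowMoment β x 1 i t)) t := by
  have h0 := rowSum_pos β x hm i t
  refine ((hasDerivAt_rowSum β x hm i t).rpow_const (p := -δ) (Or.inl h0.ne')).congr_deriv ?_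
  rw [Real.rpow_sub_one h0.ne']
  field_simp

lemma hasDerivAt_totalSum (hn : 1 ≤ n) (hm : 1 ≤ m) (t : ℝ) :
    HasDerivAt (totalSum β δ x) (-(δ * β) * (totalSum β δ x t * rayDeriv β δ x t)) t := by
  have h0 := (totalSum_pos β δ x hn hm t).ne'
  refine (HasDerivAt.fun_sum fun i _ => hasDerivAt_rowSum_rpow β δ x hm i t).congr_deriv ?_
  rw [← Finset.mul_sum, rayDeriv]
  congr 1
  rw [Finset.mul_sum]
  refine Finset.sum_congr rfl fun i _ => ?_
  rw [rowWeight]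
  field_simp

lemma hasDerivAt_rowWeight (hn : 1 ≤ n) (hm : 1 ≤ m) (i : Fin n) (t : ℝ) :
    HasDerivAt (rowWeight β δ x i)
      (-(δ * β) * (rowWeight β δ x i t * (rowMoment β x 1 i t - rayDeriv β δ x t))) t := by
  have h0 := (totalSum_pos β δ x hn hm t).ne'
  refine ((hasDerivAt_rowSum_rpow β δ x hm i t).div
    (hasDerivAt_totalSum β δ x hn hm t) h0).congr_deriv ?_
  rw [rowWeight]
  field_simp
  ring

lemma hasDerivAt_sum_rowWeight_mul (hn : 1 ≤ n) (hm : 1 ≤ m) {u : Fin n → ℝ → ℝ}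
    {d : Fin n → ℝ} {t : ℝ} (hu : ∀ i, HasDerivAt (u i) (d i) t) :
    HasDerivAt (fun t => ∑ i, rowWeight β δ x i t * u i t)
      (∑ i, rowWeight β δ x i t * (d i - δ * β * (rowMoment β x 1 i t * u i t))
        + δ * β * rayDeriv β δ x t * ∑ i, rowWeight β δ x i t * u i t) t := by
  refine (HasDerivAt.fun_sum fun i _ =>
    (hasDerivAt_rowWeight β δ x hn hm i t).mul (hu i)).congr_deriv ?_
  rw [Finset.mul_sum, ← Finset.sum_add_distrib]
  exact Finset.sum_congr rfl fun i _ => by ring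

lemma hasDerivAt_Fbd_ray (hβ : β ≠ 0) (hδ : δ ≠ 0) (hn : 1 ≤ n) (hm : 1 ≤ m) (t : ℝ) :
    HasDerivAt (fun t : ℝ => Fbd β δ (t • x)) (rayDeriv β δ x t) t := by
  have h0 := (totalSum_pos β δ x hn hm t).ne'
  refine (((hasDerivAt_totalSum β δ x hn hm t).log h0).const_mul
    (-(1 / (β * δ)))).congr_deriv ?_
  field_simp

lemma hasDerivAt_rayDeriv (hn : 1 ≤ n) (hm : 1 ≤ m) (t : ℝ) :
    HasDerivAt (rayDeriv β δ x) (rayDeriv2 β δ x t) t := by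
  refine (hasDerivAt_sum_rowWeight_mul β δ x hn hm
    fun i => hasDerivAt_rowMoment β x hm 1 i t).congr_deriv ?_
  change _ + δ * β * rayDeriv β δ x t * rayDeriv β δ x t = _
  rw [rayDeriv2, pow_two (rayDeriv β δ x t), mul_assoc (δ * β)]
  congr 1
  exact Finset.sum_congr rfl fun i _ => by ring

lemma hasDerivAt_rayDeriv2 (hn : 1 ≤ n) (hm : 1 ≤ m) (t : ℝ) :
    HasDerivAt (rayDeriv2 β δ x) (rayDeriv3 β δ x t) t := by
  have hu (i : Fin n) := ((hasDerivAt_rowMoment β x hm 2 i t).sub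
    (((hasDerivAt_rowMoment β x hm 1 i t).pow 2).const_mul (1 + δ))).const_mul β
  refine ((hasDerivAt_sum_rowWeight_mul β δ x hn hm hu).add
    (((hasDerivAt_rayDeriv β δ x hn hm t).pow 2).const_mul (δ * β))).congr_deriv ?_
  simp only [rayDeriv3, Pi.sub_apply, Pi.pow_apply]
  norm_num
  exact Finset.sum_congr rfl fun i _ => by ring

variable {β δ x}

lemma abs_rayDeriv_le (hn : 1 ≤ n) (hm : 1 ≤ m) {K : ℝ} (hK : ∀ i j, |x i j| ≤ K) (t : ℝ) :
    |rayDeriv β δ x t| ≤ K :=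
  abs_sum_mul_le_s3 (fun i => rowWeight_nonneg β δ x hn hm i t) (sum_rowWeight β δ x hn hm t)
    fun i => by simpa using abs_rowMoment_le β x hm hK 1 i t

lemma abs_rowMoment_two_sub_le (hβ : 0 < β) (hδ : 0 < δ) (hm : 1 ≤ m)
    {K : ℝ} (hK : ∀ i j, |x i j| ≤ K) (i : Fin n) (t : ℝ) :
    |β * (rowMoment β x 2 i t - (1 + δ) * rowMoment β x 1 i t ^ 2)|
      ≤ β * (2 + δ) * K ^ 2 := by
  have h1 : |rowMoment β x 1 i t ^ 2| ≤ K ^ 2 := by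
    rw [abs_pow]
    exact pow_le_pow_left₀ (abs_nonneg _) (by simpa using abs_rowMoment_le β x hm hK 1 i t) 2
  have h2 := abs_rowMoment_le β x hm hK 2 i t
  rw [abs_mul, abs_of_pos hβ, mul_assoc]
  refine mul_le_mul_of_nonneg_left ?_ hβ.le
  calc _ ≤ |rowMoment β x 2 i t| + |(1 + δ) * rowMoment β x 1 i t ^ 2| := abs_sub _ _
    _ ≤ K ^ 2 + (1 + δ) * K ^ 2 := by
      rw [abs_mul, abs_of_pos (by positivity : 0 < 1 + δ)]
      gcongr
    _ = _ := by ring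

lemma abs_rayDeriv2_le (hβ : 0 < β) (hδ : 0 < δ) (hn : 1 ≤ n) (hm : 1 ≤ m)
    {K : ℝ} (hK : ∀ i j, |x i j| ≤ K) (t : ℝ) :
    |rayDeriv2 β δ x t| ≤ 2 * (β * (1 + δ)) * K ^ 2 := by
  have h1 := abs_sum_mul_le_s3 (fun i => rowWeight_nonneg β δ x hn hm i t)
    (sum_rowWeight β δ x hn hm t) fun i => abs_rowMoment_two_sub_le hβ hδ hm hK i t
  have h2 : |rayDeriv β δ x t ^ 2| ≤ K ^ 2 := by
    rw [abs_pow]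
    exact pow_le_pow_left₀ (abs_nonneg _) (abs_rayDeriv_le hn hm hK t) 2
  refine (abs_add_le _ _).trans ?_
  rw [abs_mul (δ * β), abs_of_pos (mul_pos hδ hβ)]
  calc _ ≤ β * (2 + δ) * K ^ 2 + δ * β * K ^ 2 := by gcongr
    _ = _ := by ring

lemma abs_rayDeriv3_le (hβ : 0 < β) (hδ : 0 < δ) (hn : 1 ≤ n) (hm : 1 ≤ m)
    {K : ℝ} (hK : ∀ i j, |x i j| ≤ K) (t : ℝ) :
    |rayDeriv3 β δ x t| ≤ 6 * (β * (1 + δ)) ^ 2 * K ^ 3 := by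
  have hK0 : 0 ≤ K := (abs_nonneg _).trans (hK ⟨0, hn⟩ ⟨0, hm⟩)
  have hD := abs_rayDeriv_le (β := β) (δ := δ) hn hm hK t
  have hD2 := abs_rayDeriv2_le hβ hδ hn hm hK t
  have hu (i : Fin n) := abs_rowMoment_two_sub_le hβ hδ hm hK i t
  have h1 := abs_sum_mul_le_s3 (fun i => rowWeight_nonneg β δ x hn hm i t)
    (sum_rowWeight β δ x hn hm t) hu
  have h2 (i : Fin n) :
      |β * (β * (rowMoment β x 3 i t - rowMoment β x 2 i t * rowMoment β x 1 i t)
          - (1 + δ) * (2 * rowMoment β x 1 i t *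
            (β * (rowMoment β x 2 i t - rowMoment β x 1 i t ^ 2))))
        - δ * β * (rowMoment β x 1 i t *
          (β * (rowMoment β x 2 i t - (1 + δ) * rowMoment β x 1 i t ^ 2)))|
      ≤ β ^ 2 * (6 + 4 * δ + δ * (2 + δ)) * K ^ 3 := by
    have m1 : |rowMoment β x 1 i t| ≤ K := by simpa using abs_rowMoment_le β x hm hK 1 i t
    have m2 := abs_rowMoment_le β x hm hK 2 i t
    have m3 := abs_rowMoment_le β x hm hK 3 i t
    have e1 : |rowMoment β x 3 i t - rowMoment β x 2 i t * rowMoment β x 1 i t|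
        ≤ 2 * K ^ 3 := by
      refine (abs_sub _ _).trans ?_
      rw [abs_mul]
      calc _ ≤ K ^ 3 + K ^ 2 * K := by gcongr
        _ = _ := by ring
    have e2 : |rowMoment β x 2 i t - rowMoment β x 1 i t ^ 2| ≤ 2 * K ^ 2 := by
      refine (abs_sub _ _).trans ?_
      rw [abs_pow]
      calc _ ≤ K ^ 2 + K ^ 2 := by gcongr
        _ = _ := by ring
    refine (abs_sub _ _).trans ?_
    rw [abs_mul β, abs_mul (δ * β), abs_mul (rowMoment β x 1 i t),
      abs_of_pos (mul_pos hδ hβ), abs_of_pos hβ]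
    have e3 : |β * (rowMoment β x 3 i t - rowMoment β x 2 i t * rowMoment β x 1 i t)
          - (1 + δ) * (2 * rowMoment β x 1 i t *
            (β * (rowMoment β x 2 i t - rowMoment β x 1 i t ^ 2)))|
        ≤ β * (2 * K ^ 3) + (1 + δ) * (2 * K * (β * (2 * K ^ 2))) := by
      refine (abs_sub _ _).trans ?_
      simp only [abs_mul β, abs_mul (1 + δ), abs_mul (2 * rowMoment β x 1 i t),
        abs_mul 2 (rowMoment β x 1 i t), abs_of_pos hβ, abs_two,
        abs_of_pos (by positivity : 0 < 1 + δ)]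
      gcongr
    calc _ ≤ β * (β * (2 * K ^ 3) + (1 + δ) * (2 * K * (β * (2 * K ^ 2))))
          + δ * β * (K * (β * (2 + δ) * K ^ 2)) := by
          gcongr
          exact hu i
      _ = _ := by ring
  have h3 := abs_sum_mul_le_s3 (fun i => rowWeight_nonneg β δ x hn hm i t)
    (sum_rowWeight β δ x hn hm t) h2
  refine (abs_add_le _ _).trans ?_
  refine (add_le_add_left (abs_add_le _ _) _).trans ?_
  rw [abs_mul (δ * β * _), abs_mul (δ * β), abs_mul (δ * β), abs_mul (2 * _), abs_mul 2,
    abs_two, abs_of_pos (mul_pos hδ hβ)]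
  calc _ ≤ β ^ 2 * (6 + 4 * δ + δ * (2 + δ)) * K ^ 3
        + δ * β * K * (β * (2 + δ) * K ^ 2)
        + δ * β * (2 * K * (2 * (β * (1 + δ)) * K ^ 2)) := by gcongr
    _ = _ := by ring

end Ray

/-! ### Taylor expansion along a ray -/

lemma abs_le_of_deriv_bound {f f' : ℝ → ℝ} {M : ℝ} (hf : ∀ t, HasDerivAt f (f' t) t)
    (h0 : f 0 = 0) (hM : ∀ t ∈ Set.Icc (0 : ℝ) 1, |f' t| ≤ M) :
    ∀ t ∈ Set.Icc (0 : ℝ) 1, |f t| ≤ M := by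
  intro t ht
  have hM0 : 0 ≤ M := (abs_nonneg _).trans (hM t ht)
  have h := (convex_Icc (0 : ℝ) 1).norm_image_sub_le_of_norm_hasDerivWithin_le
    (fun s _ => (hf s).hasDerivWithinAt) hM (Set.left_mem_Icc.2 zero_le_one) ht
  rw [h0, sub_zero, sub_zero, Real.norm_eq_abs, Real.norm_eq_abs, abs_of_nonneg ht.1] at h
  exact h.trans (mul_le_of_le_one_right hM0 ht.2)

lemma abs_taylor_two_remainder_le {f f₁ f₂ f₃ : ℝ → ℝ} {M : ℝ}
    (h : ∀ t, HasDerivAt f (f₁ t) t) (h₁ : ∀ t, HasDerivAt f₁ (f₂ t) t)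
    (h₂ : ∀ t, HasDerivAt f₂ (f₃ t) t) (hM : ∀ t, |f₃ t| ≤ M) :
    |f 1 - f 0 - f₁ 0 - f₂ 0 / 2| ≤ M := by
  have b₂ := abs_le_of_deriv_bound (fun t => (h₂ t).sub_const (f₂ 0)) (sub_self _)
    fun t _ => hM t
  have b₁ := abs_le_of_deriv_bound (f := fun t => f₁ t - f₁ 0 - t * f₂ 0)
    (fun t => (((h₁ t).sub_const (f₁ 0)).sub ((hasDerivAt_id t).mul_const (f₂ 0))).congr_deriv
      (by rw [one_mul])) (by simp) b₂
  have b₀ := abs_le_of_deriv_bound (f := fun t => f t - f 0 - t * f₁ 0 - t ^ 2 / 2 * f₂ 0)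
    (fun t => ((((h t).sub_const (f 0)).sub ((hasDerivAt_id t).mul_const (f₁ 0))).sub
      ((((hasDerivAt_id t).pow 2).div_const 2).mul_const (f₂ 0))).congr_deriv
      (by simp)) (by simp) b₁
  have := b₀ 1 (Set.right_mem_Icc.2 zero_le_one)
  convert this using 2
  ring

lemma abs_comp_Fbd_remainder_le {n m : ℕ} {β δ a b c K : ℝ} (hβ : 0 < β) (hδ : 0 < δ)
    (hn : 1 ≤ n) (hm : 1 ≤ m) {g : ℝ → ℝ} (hg : ContDiff ℝ (⊤ : ℕ∞) g)
    (ha : ∀ t, |deriv g t| ≤ a) (hb : ∀ t, |deriv (deriv g) t| ≤ b)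
    (hc : ∀ t, |deriv (deriv (deriv g)) t| ≤ c) (x : Fin n → Fin m → ℝ)
    (hK : ∀ i j, |x i j| ≤ K) :
    |g (Fbd β δ x) - g (Fbd β δ (0 : Fin n → Fin m → ℝ))
        - deriv g (Fbd β δ (0 : Fin n → Fin m → ℝ)) * rayDeriv β δ x 0
        - (deriv (deriv g) (Fbd β δ (0 : Fin n → Fin m → ℝ)) * rayDeriv β δ x 0 ^ 2
          + deriv g (Fbd β δ (0 : Fin n → Fin m → ℝ)) * rayDeriv2 β δ x 0) / 2|
      ≤ (c + 6 * (β * (1 + δ)) * b + 6 * (β * (1 + δ)) ^ 2 * a) * K ^ 3 := by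
  have hK0 : 0 ≤ K := (abs_nonneg _).trans (hK ⟨0, hn⟩ ⟨0, hm⟩)
  have ha0 : 0 ≤ a := (abs_nonneg _).trans (ha 0)
  have hb0 : 0 ≤ b := (abs_nonneg _).trans (hb 0)
  have hc0 : 0 ≤ c := (abs_nonneg _).trans (hc 0)
  have hg1 : ContDiff ℝ (⊤ : ℕ∞) (deriv g) := (contDiff_infty_iff_deriv.1 hg).2
  have hg2 : ContDiff ℝ (⊤ : ℕ∞) (deriv (deriv g)) := (contDiff_infty_iff_deriv.1 hg1).2
  have d0 (s) : HasDerivAt g (deriv g s) s :=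
    ((contDiff_infty_iff_deriv.1 hg).1 s).hasDerivAt
  have d1 (s) : HasDerivAt (deriv g) (deriv (deriv g) s) s :=
    ((contDiff_infty_iff_deriv.1 hg1).1 s).hasDerivAt
  have d2 (s) : HasDerivAt (deriv (deriv g)) (deriv (deriv (deriv g)) s) s :=
    ((contDiff_infty_iff_deriv.1 hg2).1 s).hasDerivAt
  have hF (t) := hasDerivAt_Fbd_ray β δ x hβ.ne' hδ.ne' hn hm t
  have hF1 (t) := hasDerivAt_rayDeriv β δ x hn hm t
  have hF2 (t) := hasDerivAt_rayDeriv2 β δ x hn hm t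
  have key := abs_taylor_two_remainder_le
    (M := (c + 6 * (β * (1 + δ)) * b + 6 * (β * (1 + δ)) ^ 2 * a) * K ^ 3)
    (f := fun t : ℝ => g (Fbd β δ (t • x)))
    (f₁ := fun t : ℝ => deriv g (Fbd β δ (t • x)) * rayDeriv β δ x t)
    (f₂ := fun t : ℝ => deriv (deriv g) (Fbd β δ (t • x)) * rayDeriv β δ x t ^ 2
      + deriv g (Fbd β δ (t • x)) * rayDeriv2 β δ x t)
    (f₃ := fun t : ℝ => deriv (deriv (deriv g)) (Fbd β δ (t • x)) * rayDeriv β δ x t ^ 3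
      + 3 * (deriv (deriv g) (Fbd β δ (t • x)) * (rayDeriv β δ x t * rayDeriv2 β δ x t))
      + deriv g (Fbd β δ (t • x)) * rayDeriv3 β δ x t)
    (fun t => (d0 _).comp t (hF t))
    (fun t => (((d1 _).comp t (hF t)).mul (hF1 t)).congr_deriv (by
      simp only [Function.comp_apply]; ring))
    (fun t => ((((d2 _).comp t (hF t)).mul ((hF1 t).pow 2)).add
      (((d1 _).comp t (hF t)).mul (hF2 t))).congr_deriv (by
      simp only [Function.comp_apply, Pi.pow_apply]; norm_num; ring))
    (fun t => by
      have h1 := abs_rayDeriv_le (β := β) (δ := δ) hn hm hK t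
      have h2 := abs_rayDeriv2_le hβ hδ hn hm hK t
      have h3 := abs_rayDeriv3_le hβ hδ hn hm hK t
      refine (abs_add_three _ _ _).trans ?_
      simp only [abs_mul, abs_pow, abs_of_pos (three_pos : (0 : ℝ) < 3)]
      calc _ ≤ c * K ^ 3 + 3 * (b * (K * (2 * (β * (1 + δ)) * K ^ 2)))
            + a * (6 * (β * (1 + δ)) ^ 2 * K ^ 3) := by
            gcongr
            exacts [hc _, hb _, ha _]
        _ = _ := by ring)
  simpa using key

/-! ### The quadratic part of the expansion at the origin -/

section Origin

variable {n m : ℕ} (β δ : ℝ) (x : Fin n → Fin m → ℝ)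

lemma rowWeight_zero (hm : 1 ≤ m) (i : Fin n) : rowWeight β δ x i 0 = (n : ℝ)⁻¹ := by
  have hm' : (0 : ℝ) < (m : ℝ) ^ (-δ) := Real.rpow_pos_of_pos (by positivity) _
  have : (0 : ℝ) < n := by exact_mod_cast i.pos
  simp only [rowWeight, totalSum, rowSum, zero_mul, mul_zero, Real.exp_zero, Finset.sum_const,
    Finset.card_univ, Fintype.card_fin, nsmul_eq_mul, mul_one]
  field_simp

lemma rowMoment_zero (k : ℕ) (i : Fin n) : rowMoment β x k i 0 = finAvg fun j => x i j ^ k := by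
  simp [rowMoment, rowSum, finAvg, div_eq_inv_mul]

lemma rayDeriv_zero (hm : 1 ≤ m) :
    rayDeriv β δ x 0 = finAvg fun i => finAvg fun j => x i j := by
  simp only [rayDeriv, rowWeight_zero β δ x hm, rowMoment_zero, pow_one]
  rw [← Finset.mul_sum, finAvg]

lemma rayDeriv_zero_sq (hm : 1 ≤ m) :
    rayDeriv β δ x 0 ^ 2 = finAvg fun i => finAvg fun k => finAvg fun j => finAvg fun l =>
      x i j * x k l := by
  simp only [rayDeriv_zero β δ x hm, pow_two, finAvg_mul_finAvg]

lemma rayDeriv2_zero (hm : 1 ≤ m) :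
    rayDeriv2 β δ x 0 = β * (finAvg fun i => finAvg fun j => x i j * x i j)
      - β * (1 + δ) * (finAvg fun i => finAvg fun j => finAvg fun l => x i j * x i l)
      + δ * β * rayDeriv β δ x 0 ^ 2 := by
  simp only [rayDeriv2, rowWeight_zero β δ x hm, rowMoment_zero, pow_one, ← Finset.mul_sum]
  simp only [finAvg, Finset.sum_sub_distrib, mul_pow, pow_two (∑ j, x _ j),
    pow_two (x _ _), ← Finset.mul_sum, ← Finset.sum_mul]
  ring

end Origin

/-- A linear functional of the array of products of entries, with uniform weights. -/
noncomputable def pairForm {n m : ℕ} (a b c : ℝ) (y : Fin n → Fin m → Fin n → Fin m → ℝ) : ℝ :=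
  a * (finAvg fun i => finAvg fun k => finAvg fun j => finAvg fun l => y i j k l)
    + b * (finAvg fun i => finAvg fun j => y i j i j)
    + c * (finAvg fun i => finAvg fun j => finAvg fun l => y i j i l)

lemma pairForm_sub {n m : ℕ} (a b c : ℝ) (y z : Fin n → Fin m → Fin n → Fin m → ℝ) :
    pairForm a b c y - pairForm a b c z
      = pairForm a b c fun i j k l => y i j k l - z i j k l := by
  simp only [pairForm, ← finAvg_sub]
  ring

lemma abs_pairForm_le {n m : ℕ} (hn : 1 ≤ n) (hm : 1 ≤ m) {a b c B : ℝ}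
    {y : Fin n → Fin m → Fin n → Fin m → ℝ} (hy : ∀ i j k l, |y i j k l| ≤ B) :
    |pairForm a b c y| ≤ (|a| + |b| + |c|) * B := by
  refine (abs_add_three _ _ _).trans ?_
  simp only [abs_mul, add_mul]
  gcongr
  · exact abs_finAvg_le hn fun i => abs_finAvg_le hn fun k => abs_finAvg_le hm fun j =>
      abs_finAvg_le hm fun l => hy i j k l
  · exact abs_finAvg_le hn fun i => abs_finAvg_le hm fun j => hy i j i j
  · exact abs_finAvg_le hn fun i => abs_finAvg_le hm fun j =>
      abs_finAvg_le hm fun l => hy i j i l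

section Integral

variable {n m : ℕ} {Ω : Type*} [MeasurableSpace Ω] {P : Measure Ω}

lemma integrable_pairForm {a b c : ℝ} {y : Ω → Fin n → Fin m → Fin n → Fin m → ℝ}
    (hy : ∀ i j k l, Integrable (fun ω => y ω i j k l) P) :
    Integrable (fun ω => pairForm a b c (y ω)) P := by
  refine (Integrable.add ?_ ?_).add ?_ <;> refine Integrable.const_mul ?_ _
  · exact integrable_finAvg fun i => integrable_finAvg fun k => integrable_finAvg fun j =>
      integrable_finAvg fun l => hy i j k l
  · exact integrable_finAvg fun i => integrable_finAvg fun j => hy i j i j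
  · exact integrable_finAvg fun i => integrable_finAvg fun j =>
      integrable_finAvg fun l => hy i j i l

lemma integral_pairForm {a b c : ℝ} {y : Ω → Fin n → Fin m → Fin n → Fin m → ℝ}
    (hy : ∀ i j k l, Integrable (fun ω => y ω i j k l) P) :
    ∫ ω, pairForm a b c (y ω) ∂P = pairForm a b c fun i j k l => ∫ ω, y ω i j k l ∂P := by
  have i1 (i k j) := integrable_finAvg fun l => hy i j k l
  have i2 (i k) := integrable_finAvg fun j => i1 i k j
  have i3 (i) := integrable_finAvg fun k => i2 i k
  have j1 (i) := integrable_finAvg fun j => hy i j i j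
  have k1 (i j) := integrable_finAvg fun l => hy i j i l
  have k2 (i) := integrable_finAvg fun j => k1 i j
  have hab : Integrable (fun ω => a * (finAvg fun i => finAvg fun k => finAvg fun j =>
      finAvg fun l => y ω i j k l) + b * (finAvg fun i => finAvg fun j => y ω i j i j)) P :=
    ((integrable_finAvg i3).const_mul a).add ((integrable_finAvg j1).const_mul b)
  unfold pairForm
  rw [integral_add hab ((integrable_finAvg k2).const_mul c),
    integral_add ((integrable_finAvg i3).const_mul a) ((integrable_finAvg j1).const_mul b), integral_const_mul, integral_const_mul,
    integral_const_mul, integral_finAvg i3, integral_finAvg j1, integral_finAvg k2]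
  simp only [fun i => integral_finAvg (i2 i), fun i k => integral_finAvg (i1 i k),
    fun i k j => integral_finAvg fun l => hy i j k l,
    fun i => integral_finAvg fun j => hy i j i j]

lemma integrable_mul_of_integrable_abs_cube [IsFiniteMeasure P] {u v : Ω → ℝ} (hu : Measurable u)
    (hv : Measurable v) (hu3 : Integrable (fun ω => |u ω| ^ 3) P)
    (hv3 : Integrable (fun ω => |v ω| ^ 3) P) : Integrable (fun ω => u ω * v ω) P := by
  refine ((hu3.add hv3).add (integrable_const 1)).mono' (hu.mul hv).aestronglyMeasurable ?_
  refine Filter.Eventually.of_forall fun ω => ?_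
  simp only [Real.norm_eq_abs, abs_mul, Pi.add_apply]
  have h (s : ℝ) (hs : 0 ≤ s) : s ^ 2 ≤ s ^ 3 + 1 := by
    nlinarith [mul_nonneg hs (sq_nonneg (s - 1)), sq_nonneg (s - 1)]
  have h1 := h _ (abs_nonneg (u ω))
  have h2 := h _ (abs_nonneg (v ω))
  have h3 : 0 ≤ |u ω| ^ 3 := by positivity
  have h4 : 0 ≤ |v ω| ^ 3 := by positivity
  nlinarith [sq_nonneg (|u ω| - |v ω|)]

lemma integrable_of_integrable_abs_cube [IsFiniteMeasure P] {u : Ω → ℝ} (hu : Measurable u)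
    (hu3 : Integrable (fun ω => |u ω| ^ 3) P) : Integrable u P := by
  refine (hu3.add (integrable_const 1)).mono' hu.aestronglyMeasurable ?_
  refine Filter.Eventually.of_forall fun ω => ?_
  simp only [Real.norm_eq_abs, Pi.add_apply]
  nlinarith [abs_nonneg (u ω), mul_nonneg (abs_nonneg (u ω)) (sq_nonneg (|u ω| - 1)),
    sq_nonneg (|u ω| - 1)]

lemma le_iSup_iSup_fin (u : Fin n → Fin m → ℝ) (i : Fin n) (j : Fin m) :
    u i j ≤ ⨆ i, ⨆ j, u i j :=
  (le_ciSup (Set.finite_range (u i)).bddAbove j).trans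
    (le_ciSup (f := fun i => ⨆ j, u i j) (Set.finite_range _).bddAbove i)

lemma integrable_iSup_iSup_abs_cube {X : Ω → Fin n → Fin m → ℝ} (hX : Measurable X)
    (h3 : ∀ i j, Integrable (fun ω => |X ω i j| ^ 3) P) :
    Integrable (fun ω => ⨆ i, ⨆ j, |X ω i j| ^ 3) P := by
  have hm (i j) : Measurable fun ω => X ω i j := by fun_prop
  refine (integrable_finsetSum Finset.univ fun i _ =>
    integrable_finsetSum Finset.univ fun j _ => h3 i j).mono' ?_ ?_
  · exact (Measurable.iSup fun i => Measurable.iSup fun j =>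
      ((hm i j).abs.pow_const 3)).aestronglyMeasurable
  · refine Filter.Eventually.of_forall fun ω => ?_
    have h0 (i : Fin n) (j : Fin m) : 0 ≤ |X ω i j| ^ 3 := by positivity
    rw [Real.norm_of_nonneg (Real.iSup_nonneg fun i => Real.iSup_nonneg fun j => h0 i j)]
    refine Real.iSup_le (fun i => Real.iSup_le (fun j => ?_) ?_) ?_
    · exact (Finset.single_le_sum (fun j _ => h0 i j) (Finset.mem_univ j)).trans
        (Finset.single_le_sum (f := fun i => ∑ j, |X ω i j| ^ 3)
          (fun i _ => Finset.sum_nonneg fun j _ => h0 i j) (Finset.mem_univ i))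
    all_goals exact Finset.sum_nonneg fun i _ => Finset.sum_nonneg fun j _ => h0 i j

lemma measurable_Fbd (β δ : ℝ) {X : Ω → Fin n → Fin m → ℝ} (hX : Measurable X) :
    Measurable fun ω => Fbd β δ (X ω) := by
  have hm (i j) : Measurable fun ω => X ω i j := by fun_prop
  unfold Fbd
  fun_prop

lemma abs_integral_comp_Fbd_sub_le [IsProbabilityMeasure P] {β δ a b c : ℝ} (hβ : 0 < β)
    (hδ : 0 < δ) (hn : 1 ≤ n) (hm : 1 ≤ m) {g : ℝ → ℝ} (hg : ContDiff ℝ (⊤ : ℕ∞) g)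
    (ha : ∀ t, |deriv g t| ≤ a) (hb : ∀ t, |deriv (deriv g) t| ≤ b)
    (hc : ∀ t, |deriv (deriv (deriv g)) t| ≤ c) {X : Ω → Fin n → Fin m → ℝ} (hX : Measurable X)
    (hX0 : ∀ i j, ∫ ω, X ω i j ∂P = 0) (hX3 : ∀ i j, Integrable (fun ω => |X ω i j| ^ 3) P)
    {z A B : ℝ} (hz : z = Fbd β δ (0 : Fin n → Fin m → ℝ)) (hA : A = deriv g z)
    (hB : B = deriv (deriv g) z) :
    |∫ ω, g (Fbd β δ (X ω)) ∂P - (g z + pairForm (B + A * (δ * β)) (A * β)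
        (-(A * (β * (1 + δ)))) (fun i j k l => ∫ ω, X ω i j * X ω k l ∂P) / 2)|
      ≤ (c + 6 * (β * (1 + δ)) * b + 6 * (β * (1 + δ)) ^ 2 * a)
        * ∫ ω, ⨆ i, ⨆ j, |X ω i j| ^ 3 ∂P := by
  have hXm (i j) : Measurable fun ω => X ω i j := by fun_prop
  have hX1 (i j) := integrable_of_integrable_abs_cube (hXm i j) (hX3 i j)
  have hX2 (i j k l) :=
    integrable_mul_of_integrable_abs_cube (hXm i j) (hXm k l) (hX3 i j) (hX3 k l)
  have ha0 : 0 ≤ a := (abs_nonneg _).trans (ha 0)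
  have hb0 : 0 ≤ b := (abs_nonneg _).trans (hb 0)
  have hc0 : 0 ≤ c := (abs_nonneg _).trans (hc 0)
  set M := c + 6 * (β * (1 + δ)) * b + 6 * (β * (1 + δ)) ^ 2 * a
  have hM : 0 ≤ M := by positivity
  let lin (ω : Ω) : ℝ := A * finAvg fun i => finAvg fun j => X ω i j
  let quad (ω : Ω) : ℝ := pairForm (B + A * (δ * β)) (A * β) (-(A * (β * (1 + δ))))
    (fun i j k l => X ω i j * X ω k l) / 2
  have hlin : Integrable lin P :=
    (integrable_finAvg fun i => integrable_finAvg fun j => hX1 i j).const_mul A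
  have hquad : Integrable quad P := (integrable_pairForm hX2).div_const 2
  have hlin0 : ∫ ω, lin ω ∂P = 0 := by
    simp only [lin]
    rw [integral_const_mul,
      integral_finAvg fun i => integrable_finAvg fun j => hX1 i j]
    simp only [fun i => integral_finAvg fun j => hX1 i j, hX0]
    simp [finAvg]
  have hquad0 : ∫ ω, quad ω ∂P = pairForm (B + A * (δ * β)) (A * β) (-(A * (β * (1 + δ))))
      (fun i j k l => ∫ ω, X ω i j * X ω k l ∂P) / 2 := by
    simp only [quad]
    rw [integral_div, integral_pairForm hX2]
  have hrem (ω) : ‖g (Fbd β δ (X ω)) - (g z + lin ω + quad ω)‖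
      ≤ M * ⨆ i, ⨆ j, |X ω i j| ^ 3 := by
    have : Nonempty (Fin n × Fin m) := ⟨⟨0, hn⟩, ⟨0, hm⟩⟩
    obtain ⟨p, hp⟩ := Finite.exists_max fun q : Fin n × Fin m => |X ω q.1 q.2|
    refine le_trans ?_ (mul_le_mul_of_nonneg_left
      (le_iSup_iSup_fin (fun i j => |X ω i j| ^ 3) p.1 p.2) hM)
    have h := abs_comp_Fbd_remainder_le hβ hδ hn hm hg ha hb hc (X ω) fun i j => hp (i, j)
    rw [Real.norm_eq_abs]
    refine (congrArg abs ?_).trans_le h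
    rw [rayDeriv2_zero β δ _ hm, rayDeriv_zero_sq β δ _ hm, rayDeriv_zero β δ _ hm, ← hz, ← hA,
      ← hB]
    simp only [lin, quad, pairForm]
    ring
  have hsup := (integrable_iSup_iSup_abs_cube hX hX3).const_mul M
  have haff : Integrable (fun ω => g z + lin ω) P := (integrable_const _).add hlin
  have hpoly : Integrable (fun ω => g z + lin ω + quad ω) P := haff.add hquad
  have hmeas : Measurable fun ω => g (Fbd β δ (X ω)) :=
    hg.continuous.measurable.comp (measurable_Fbd β δ hX)
  have hR : Integrable (fun ω => g (Fbd β δ (X ω)) - (g z + lin ω + quad ω)) P :=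
    hsup.mono' (hmeas.aestronglyMeasurable.sub hpoly.aestronglyMeasurable)
      (Filter.Eventually.of_forall hrem)
  have hG : Integrable (fun ω => g (Fbd β δ (X ω))) P := by
    refine (hR.add hpoly).congr (Filter.Eventually.of_forall fun ω => ?_)
    simp
  have hpoly0 : ∫ ω, (g z + lin ω + quad ω) ∂P = g z + ∫ ω, quad ω ∂P := by
    rw [integral_add haff hquad, integral_add (integrable_const _) hlin, hlin0]
    simp
  rw [← hquad0, ← hpoly0, ← integral_sub hG hpoly, ← integral_const_mul, ← Real.norm_eq_abs]
  exact norm_integral_le_of_norm_le hsup (Filter.Eventually.of_forall hrem)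

end Integral

theorem stmt_3 (C₀ : ℝ) (hC₀ : 0 < C₀) :
    ∃ C : ℝ, 0 < C ∧
      ∀ (n m : ℕ), 1 ≤ n → 1 ≤ m →
      ∀ (Ω : Type) [MeasurableSpace Ω] (P : Measure Ω), IsProbabilityMeasure P →
      ∀ (X X' : Ω → Fin n → Fin m → ℝ), Measurable X → Measurable X' →
      (∀ i j, ∫ ω, X ω i j ∂P = 0) → (∀ i j, ∫ ω, X' ω i j ∂P = 0) →
      (∀ i j, Integrable (fun ω => |X ω i j| ^ 3) P) →
      (∀ i j, Integrable (fun ω => |X' ω i j| ^ 3) P) →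
      ∀ (β δ τ : ℝ), 0 < β → 0 < δ → 1 / (β * (1 + δ)) < τ →
      ∀ g : ℝ → ℝ, ContDiff ℝ (⊤ : ℕ∞) g →
      (∀ t, |deriv g t| ≤ τ⁻¹) →
      (∀ t, |deriv (deriv g) t| ≤ C₀ * β * (1 + δ) * τ⁻¹) →
      (∀ t, |deriv (deriv (deriv g)) t| ≤ C₀ * β ^ 2 * (1 + δ) ^ 2 * τ⁻¹) →
      |(∫ ω, g (Fbd β δ (X ω)) ∂P) - ∫ ω, g (Fbd β δ (X' ω)) ∂P| ≤
        C * β * (1 + δ) / τ *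
          ((∫ ω, ⨆ i₁, ⨆ j₁, ⨆ i₂, ⨆ j₂,
              |X ω i₁ j₁ * X ω i₂ j₂ - ∫ ω', X ω' i₁ j₁ * X ω' i₂ j₂ ∂P| ∂P)
            + (∫ ω, ⨆ i₁, ⨆ j₁, ⨆ i₂, ⨆ j₂,
                |X' ω i₁ j₁ * X' ω i₂ j₂ - ∫ ω', X' ω' i₁ j₁ * X' ω' i₂ j₂ ∂P| ∂P)
            + (⨆ i₁, ⨆ j₁, ⨆ i₂, ⨆ j₂,
                |∫ ω, (X ω i₁ j₁ * X ω i₂ j₂ - X' ω i₁ j₁ * X' ω i₂ j₂) ∂P|)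
            + β * (1 + δ) *
                ((∫ ω, ⨆ i, ⨆ j, |X ω i j| ^ 3 ∂P) + ∫ ω, ⨆ i, ⨆ j, |X' ω i j| ^ 3 ∂P)) := by
  refine ⟨7 * C₀ + 6, by positivity, ?_⟩
  intro n m hn hm Ω _ P _ X X' hX hX' hX0 hX0' hX3 hX3' β δ τ hβ hδ hτ g hg hg1 hg2 hg3
  have hτ0 : 0 < τ := lt_trans (by positivity) hτ
  have hXm (i j) : Measurable fun ω => X ω i j := by fun_prop
  have hXm' (i j) : Measurable fun ω => X' ω i j := by fun_prop
  obtain ⟨z, hz⟩ : ∃ z, z = Fbd β δ (0 : Fin n → Fin m → ℝ) := ⟨_, rfl⟩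
  have h := abs_integral_comp_Fbd_sub_le hβ hδ hn hm hg hg1 hg2 hg3 hX hX0 hX3 hz rfl rfl
  have h' := abs_integral_comp_Fbd_sub_le hβ hδ hn hm hg hg1 hg2 hg3 hX' hX0' hX3' hz rfl rfl
  have hB₁ : 0 ≤ ∫ ω, ⨆ i₁, ⨆ j₁, ⨆ i₂, ⨆ j₂,
      |X ω i₁ j₁ * X ω i₂ j₂ - ∫ ω', X ω' i₁ j₁ * X ω' i₂ j₂ ∂P| ∂P :=
    integral_nonneg fun ω => Real.iSup_nonneg fun _ => Real.iSup_nonneg fun _ =>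
      Real.iSup_nonneg fun _ => Real.iSup_nonneg fun _ => abs_nonneg _
  have hB₁' : 0 ≤ ∫ ω, ⨆ i₁, ⨆ j₁, ⨆ i₂, ⨆ j₂,
      |X' ω i₁ j₁ * X' ω i₂ j₂ - ∫ ω', X' ω' i₁ j₁ * X' ω' i₂ j₂ ∂P| ∂P :=
    integral_nonneg fun ω => Real.iSup_nonneg fun _ => Real.iSup_nonneg fun _ =>
      Real.iSup_nonneg fun _ => Real.iSup_nonneg fun _ => abs_nonneg _
  have hB₂ : 0 ≤ ∫ ω, ⨆ i, ⨆ j, |X ω i j| ^ 3 ∂P :=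
    integral_nonneg fun ω => Real.iSup_nonneg fun _ => Real.iSup_nonneg fun _ => by positivity
  have hB₂' : 0 ≤ ∫ ω, ⨆ i, ⨆ j, |X' ω i j| ^ 3 ∂P :=
    integral_nonneg fun ω => Real.iSup_nonneg fun _ => Real.iSup_nonneg fun _ => by positivity
  have hB₃ (i₁ j₁ i₂ j₂) :
      |∫ ω, X ω i₁ j₁ * X ω i₂ j₂ ∂P - ∫ ω, X' ω i₁ j₁ * X' ω i₂ j₂ ∂P|
      ≤ ⨆ i₁, ⨆ j₁, ⨆ i₂, ⨆ j₂,
        |∫ ω, (X ω i₁ j₁ * X ω i₂ j₂ - X' ω i₁ j₁ * X' ω i₂ j₂) ∂P| := by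
    rw [← integral_sub
      (integrable_mul_of_integrable_abs_cube (hXm i₁ j₁) (hXm i₂ j₂) (hX3 i₁ j₁) (hX3 i₂ j₂))
      (integrable_mul_of_integrable_abs_cube (hXm' i₁ j₁) (hXm' i₂ j₂) (hX3' i₁ j₁)
        (hX3' i₂ j₂))]
    exact (le_iSup_iSup_fin (fun i₂ j₂ =>
      |∫ ω, (X ω i₁ j₁ * X ω i₂ j₂ - X' ω i₁ j₁ * X' ω i₂ j₂) ∂P|) i₂ j₂).trans
      (le_iSup_iSup_fin (fun i₁ j₁ => ⨆ i₂, ⨆ j₂,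
        |∫ ω, (X ω i₁ j₁ * X ω i₂ j₂ - X' ω i₁ j₁ * X' ω i₂ j₂) ∂P|) i₁ j₁)
  have hq := (congrArg abs (pairForm_sub _ _ _ _ _)).trans_le (abs_pairForm_le hn hm hB₃
    (a := deriv (deriv g) z + deriv g z * (δ * β)) (b := deriv g z * β)
    (c := -(deriv g z * (β * (1 + δ)))))
  have hB₃0 := (abs_nonneg _).trans (hB₃ ⟨0, hn⟩ ⟨0, hm⟩ ⟨0, hn⟩ ⟨0, hm⟩)
  have hcoef : |deriv (deriv g) z + deriv g z * (δ * β)| + |deriv g z * β|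
      + |-(deriv g z * (β * (1 + δ)))| ≤ (C₀ + 2) * (β * (1 + δ) * τ⁻¹) := by
    rw [abs_neg, abs_mul, abs_mul, abs_of_pos hβ, abs_of_pos (by positivity : 0 < β * (1 + δ))]
    have h1 := abs_add_le (deriv (deriv g) z) (deriv g z * (δ * β))
    rw [abs_mul, abs_of_pos (mul_pos hδ hβ)] at h1
    have h2 := mul_le_mul_of_nonneg_right (hg1 z) (by positivity : 0 ≤ 2 * (β * (1 + δ)))
    linarith [hg2 z]
  generalize (∫ ω, ⨆ i₁, ⨆ j₁, ⨆ i₂, ⨆ j₂,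
      |X ω i₁ j₁ * X ω i₂ j₂ - ∫ ω', X ω' i₁ j₁ * X ω' i₂ j₂ ∂P| ∂P) = B₁ at *
  generalize (∫ ω, ⨆ i₁, ⨆ j₁, ⨆ i₂, ⨆ j₂,
      |X' ω i₁ j₁ * X' ω i₂ j₂ - ∫ ω', X' ω' i₁ j₁ * X' ω' i₂ j₂ ∂P| ∂P) = B₁' at *
  generalize (⨆ i₁, ⨆ j₁, ⨆ i₂, ⨆ j₂,
      |∫ ω, (X ω i₁ j₁ * X ω i₂ j₂ - X' ω i₁ j₁ * X' ω i₂ j₂) ∂P|) = B₃ at *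
  generalize (∫ ω, ⨆ i, ⨆ j, |X ω i j| ^ 3 ∂P) = B₂ at *
  generalize (∫ ω, ⨆ i, ⨆ j, |X' ω i j| ^ 3 ∂P) = B₂' at *
  have hq' := hq.trans (mul_le_mul_of_nonneg_right hcoef hB₃0)
  obtain ⟨s, hs⟩ : ∃ s, s = β * (1 + δ) := ⟨_, rfl⟩
  have hs0 : 0 < s := hs ▸ by positivity
  have hcube : C₀ * β ^ 2 * (1 + δ) ^ 2 * τ⁻¹ + 6 * (β * (1 + δ)) * (C₀ * β * (1 + δ) * τ⁻¹)
      + 6 * (β * (1 + δ)) ^ 2 * τ⁻¹ = (7 * C₀ + 6) * (s * τ⁻¹) * s := by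
    rw [hs]
    ring
  rw [hcube] at h h'
  have hB₃s : (C₀ + 2) * (β * (1 + δ) * τ⁻¹) * B₃ = (C₀ + 2) * (s * τ⁻¹ * B₃) := by
    rw [hs]
    ring
  rw [hB₃s] at hq'
  have hfinal : (7 * C₀ + 6) * β * (1 + δ) / τ * (B₁ + B₁' + B₃ + β * (1 + δ) * (B₂ + B₂'))
      = (7 * C₀ + 6) * (s * τ⁻¹) * (B₁ + B₁') + (7 * C₀ + 6) * (s * τ⁻¹ * B₃)
        + (7 * C₀ + 6) * (s * τ⁻¹) * s * B₂ + (7 * C₀ + 6) * (s * τ⁻¹) * s * B₂' := by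
    rw [hs]
    ring
  have hp : 0 ≤ (7 * C₀ + 6) * (s * τ⁻¹) * (B₁ + B₁') := by positivity
  have hp3 : 0 ≤ s * τ⁻¹ * B₃ := by positivity
  have hp3' := mul_nonneg hC₀.le hp3
  rw [hfinal]
  rw [abs_le] at h h' hq' ⊢
  constructor <;> linarith [h.1, h.2, h'.1, h'.2, hq'.1, hq'.2]
end

section
/- For every β > 0, δ > 0 and every x ∈ ℝ^{n×m}, the function F^{βδ}(x) = −(1/(βδ)) log Σ_{i=1}^n (Σ_{j=1}^m exp(β x_{i,j}))^{−δ} satisfies min_{1≤i≤n} max_{1≤j≤m} x_{i,j} − (log n)/(βδ) ≤ F^{βδ}(x) ≤ min_{1≤i≤n} max_{1≤j≤m} x_{i,j} + (log m)/β. -/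
open Real

theorem le_log_sum_exp {ι : Type*} [Fintype ι] (y : ι → ℝ) (i : ι) :
    y i ≤ Real.log (∑ k, Real.exp (y k)) := by
  have h : Real.exp (y i) ≤ ∑ k, Real.exp (y k) :=
    Finset.single_le_sum (f := fun k => Real.exp (y k))
      (fun k _ => (Real.exp_pos _).le) (Finset.mem_univ i)
  exact (Real.le_log_iff_exp_le ((Real.exp_pos _).trans_le h)).2 h

theorem log_sum_exp_le {ι : Type*} [Fintype ι] [Nonempty ι] (y : ι → ℝ) (M : ℝ)
    (hM : ∀ i, y i ≤ M) :
    Real.log (∑ k, Real.exp (y k)) ≤ M + Real.log (Fintype.card ι) := by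
  have hpos : 0 < ∑ k, Real.exp (y k) :=
    Finset.sum_pos (fun k _ => Real.exp_pos _) Finset.univ_nonempty
  have hcard : (0 : ℝ) < Fintype.card ι := by exact_mod_cast Fintype.card_pos
  rw [Real.log_le_iff_le_exp hpos, Real.exp_add, Real.exp_log hcard, mul_comm]
  calc ∑ k, Real.exp (y k) ≤ ∑ _k : ι, Real.exp M :=
        Finset.sum_le_sum fun k _ => Real.exp_le_exp.2 (hM k)
    _ = Fintype.card ι * Real.exp M := by simp

theorem stmt_4 (n m : ℕ) (hn : 1 ≤ n) (hm : 1 ≤ m) (β δ : ℝ) (hβ : 0 < β) (hδ : 0 < δ)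
    (x : Fin n → Fin m → ℝ) :
    (⨅ i, ⨆ j, x i j) - Real.log n / (β * δ) ≤ Fbd β δ x ∧
    Fbd β δ x ≤ (⨅ i, ⨆ j, x i j) + Real.log m / β := by
  have : Nonempty (Fin n) := ⟨⟨0, hn⟩⟩
  have : Nonempty (Fin m) := ⟨⟨0, hm⟩⟩
  set L : Fin n → ℝ := fun i => Real.log (∑ j, Real.exp (β * x i j)) with hL
  have hF : Fbd β δ x = -Real.log (∑ i, Real.exp (-δ * L i)) / (β * δ) := by
    have h (i : Fin n) :
        (∑ j, Real.exp (β * x i j)) ^ (-δ) = Real.exp (-δ * L i) := by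
      rw [Real.rpow_def_of_pos
        (Finset.sum_pos (fun j _ => Real.exp_pos _) Finset.univ_nonempty), mul_comm]
    simp only [Fbd, h]
    ring
  have hβδ : 0 < β * δ := mul_pos hβ hδ
  rw [hF]
  constructor
  · have hlow (i : Fin n) : -δ * L i ≤ -(β * δ) * ⨅ i, ⨆ j, x i j := by
      obtain ⟨j, hj⟩ := exists_eq_ciSup_of_finite (f := x i)
      have h₁ : (⨅ i, ⨆ j, x i j) ≤ x i j :=
        (ciInf_le (Set.finite_range _).bddBelow i).trans_eq hj.symm
      have h₂ : β * x i j ≤ L i := le_log_sum_exp (fun j => β * x i j) j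
      have h₃ := mul_le_mul_of_nonneg_left
        ((mul_le_mul_of_nonneg_left h₁ hβ.le).trans h₂) hδ.le
      linarith
    have h := log_sum_exp_le _ _ hlow
    rw [Fintype.card_fin] at h
    rw [le_div_iff₀ hβδ, sub_mul, div_mul_cancel₀ _ hβδ.ne']
    linarith
  · obtain ⟨i, hi⟩ := exists_eq_ciInf_of_finite (f := fun i => ⨆ j, x i j)
    have hup : L i ≤ β * (⨅ i, ⨆ j, x i j) + Real.log m := by
      have h := log_sum_exp_le (fun j => β * x i j) (β * ⨆ j, x i j) fun j =>
        mul_le_mul_of_nonneg_left (le_ciSup (Set.finite_range _).bddAbove j) hβ.le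
      rwa [Fintype.card_fin, hi] at h
    have h := le_log_sum_exp (fun i => -δ * L i) i
    have h' := mul_le_mul_of_nonneg_left hup hδ.le
    have hm' : Real.log m / β * (β * δ) = δ * Real.log m := by
      field_simp
    rw [div_le_iff₀ hβδ, add_mul, hm']
    linarith
end
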